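/- arXiv:1211.0734 — 4 statements merged into one kernel-verified Lean document; each statement's English description precedes it below -/
import Mathlib

section
/- Let (A,m,k) → (A',m',k') be a weakly regular homomorphism of noetherian local rings. If M is a test module for A, then A' ⊗_A M is a test module for A'. -/
open CategoryTheory IsLocalRing

universe u

/-! ## Homological dimensions -/

/-- Flat dimension at most `n`: `M` is flat, or there is a surjection from a flat
module whose kernel has flat dimension at most `n - 1`. -/
def FlatDimLE (A : Type u) [CommRing A] :
    ℕ → ∀ (M : Type u) [AddCommGroup M] [Module A M], Prop
  | 0 => fun M _ _ => Module.Flat A M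
  | n + 1 => fun M _ _ =>
      ∃ (F : Type u) (_ : AddCommGroup F) (_ : Module A F), Module.Flat A F ∧
        ∃ f : F →ₗ[A] M, Function.Surjective f ∧ FlatDimLE A n (LinearMap.ker f)

/-- Projective dimension at most `n`. -/
def ProjDimLE (A : Type u) [CommRing A] :
    ℕ → ∀ (M : Type u) [AddCommGroup M] [Module A M], Prop
  | 0 => fun M _ _ => Module.Projective A M
  | n + 1 => fun M _ _ =>
      ∃ (P : Type u) (_ : AddCommGroup P) (_ : Module A P), Module.Projective A P ∧
        ∃ f : P →ₗ[A] M, Function.Surjective f ∧ ProjDimLE A n (LinearMap.ker f)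

/-- Injective dimension at most `n`. -/
def InjDimLE (A : Type u) [CommRing A] :
    ℕ → ∀ (M : Type u) [AddCommGroup M] [Module A M], Prop
  | 0 => fun M _ _ => Module.Injective A M
  | n + 1 => fun M _ _ =>
      ∃ (I : Type u) (_ : AddCommGroup I) (_ : Module A I), Module.Injective A I ∧
        ∃ f : M →ₗ[A] I, Function.Injective f ∧ InjDimLE A n (I ⧸ LinearMap.range f)

/-! ## Classes of local rings -/

/-- A Gorenstein (noetherian) local ring: a noetherian local ring having finite injective
dimension as a module over itself. -/
def IsGorensteinLocalRing (A : Type u) [CommRing A] : Prop :=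
  IsNoetherianRing A ∧ IsLocalRing A ∧ ∃ n : ℕ, InjDimLE A n A

/-- A regular local ring: a noetherian local ring whose maximal ideal is generated by
`dim A` elements. -/
def IsRegularLocal (A : Type u) [CommRing A] : Prop :=
  IsNoetherianRing A ∧ IsLocalRing A ∧
    ∃ s : Finset A, (Ideal.span (s : Set A)).IsMaximal ∧
      (s.card : WithBot ℕ∞) = ringKrullDim A

/-- A deformation: a surjective ring homomorphism whose kernel is generated by a
regular sequence. -/
def IsDeformation {Q A' : Type u} [CommRing Q] [CommRing A'] (f : Q →+* A') : Prop :=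
  Function.Surjective f ∧
    ∃ rs : List Q, RingTheory.Sequence.IsRegular Q rs ∧
      RingHom.ker f = Ideal.span {x | x ∈ rs}

/-- A noetherian local ring is complete intersection if its `m`-adic completion is a
quotient of a regular local ring by an ideal generated by a regular sequence. -/
def IsCompleteIntersectionLocalRing (A : Type u) [CommRing A] [IsLocalRing A] : Prop :=
  ∃ (Q : Type u) (_ : CommRing Q), IsRegularLocal Q ∧
    ∃ f : Q →+* AdicCompletion (maximalIdeal A) A, IsDeformation f

/-! ## Tor, test modules -/

/-- Vanishing of `Tor_i^A(M, N)`. -/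
def TorVanish (A : Type u) [CommRing A] (i : ℕ)
    (M : Type u) [AddCommGroup M] [Module A M]
    (N : Type u) [AddCommGroup N] [Module A N] : Prop :=
  Subsingleton (((Tor (ModuleCat.{u} A) i).obj (ModuleCat.of A M)).obj (ModuleCat.of A N))

/-- `M` is a test module for `A`: for every local homomorphism `A → B` of noetherian local
rings and every finitely generated `B`-module `N`, vanishing of `Tor_i^A(M,N)` for all
`i ≫ 0` implies that `N` has finite flat dimension over `A`. -/
def IsTestModule (A : Type u) [CommRing A] [IsLocalRing A] [IsNoetherianRing A]
    (M : Type u) [AddCommGroup M] [Module A M] : Prop :=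
  ∀ (B : Type u) [CommRing B] [IsLocalRing B] [IsNoetherianRing B] [Algebra A B],
    IsLocalHom (algebraMap A B) →
    ∀ (N : Type u) [AddCommGroup N] [Module A N] [Module B N] [IsScalarTower A B N],
      Module.Finite B N →
      (∃ i₀ : ℕ, ∀ i ≥ i₀, TorVanish A i M N) →
      ∃ n : ℕ, FlatDimLE A n N

/-- `M` is a Test module for `A`: for every finitely generated `A`-module `N`, vanishing of
`Tor_i^A(M,N)` for all `i ≫ 0` implies that `N` has finite flat dimension over `A`. -/
def IsCapitalTestModule (A : Type u) [CommRing A] [IsLocalRing A] [IsNoetherianRing A]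
    (M : Type u) [AddCommGroup M] [Module A M] : Prop :=
  ∀ (N : Type u) [AddCommGroup N] [Module A N], Module.Finite A N →
    (∃ i₀ : ℕ, ∀ i ≥ i₀, TorVanish A i M N) →
    ∃ n : ℕ, FlatDimLE A n N

/-! ## Weakly regular homomorphisms and upper CI dimension -/

/-- `A → A'` (given as an algebra) is a weakly regular local homomorphism: it is a local
homomorphism, flat, and the closed fiber `A' ⊗_A k = A'/m A'` is a regular local ring. -/
def IsWeaklyRegularAlgebra (A : Type u) [CommRing A] [IsLocalRing A]
    (A' : Type u) [CommRing A'] [Algebra A A'] : Prop :=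
  IsLocalHom (algebraMap A A') ∧ Module.Flat A A' ∧
    IsRegularLocal (A' ⧸ Ideal.map (algebraMap A A') (maximalIdeal A))

/-- `M` has finite upper complete intersection dimension `CI*-dim_A(M) < ∞`: there are a
weakly regular homomorphism `A → A'` of noetherian local rings and a deformation `Q → A'`
such that `pd_Q (A' ⊗_A M) < ∞`. -/
def CIStarDimFinite (A : Type u) [CommRing A] [IsLocalRing A]
    (M : Type u) [AddCommGroup M] [Module A M] : Prop :=
  ∃ (A' : Type u) (_ : CommRing A') (_ : IsLocalRing A') (_ : IsNoetherianRing A')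
    (_ : Algebra A A'), IsWeaklyRegularAlgebra A A' ∧
    ∃ (Q : Type u) (_ : CommRing Q) (_ : IsLocalRing Q) (_ : IsNoetherianRing Q)
      (f : Q →+* A'), IsDeformation f ∧
        ∃ n : ℕ,
          let _inst : Module Q (TensorProduct A A' M) :=
            Module.compHom (TensorProduct A A' M) f
          ProjDimLE Q n (TensorProduct A A' M)

/-! ## Gorenstein dimension -/

/-- Vanishing of `Ext^i_A(M, N)`. -/
def ExtVanish (A : Type u) [CommRing A] (i : ℕ)
    (M : Type u) [AddCommGroup M] [Module A M]
    (N : Type u) [AddCommGroup N] [Module A N] : Prop :=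
  Subsingleton (((Ext A (ModuleCat.{u} A) i).obj (Opposite.op (ModuleCat.of A M))).obj
    (ModuleCat.of A N))

/-- `G-dim_A M = 0`: the biduality map is an isomorphism and
`Ext^i(M, A) = 0 = Ext^i(M*, A)` for `i > 0`. -/
def GDimZero (A : Type u) [CommRing A] (M : Type u) [AddCommGroup M] [Module A M] : Prop :=
  Function.Bijective (Module.Dual.eval A M) ∧
    (∀ i > 0, ExtVanish A i M A) ∧
    (∀ i > 0, ExtVanish A i (Module.Dual A M) A)

/-- `G-dim_A M ≤ n`: `M` admits a resolution of length `n` by modules of G-dimension `0`. -/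
def GDimLE (A : Type u) [CommRing A] :
    ℕ → ∀ (M : Type u) [AddCommGroup M] [Module A M], Prop
  | 0 => fun M _ _ => GDimZero A M
  | n + 1 => fun M _ _ =>
      ∃ (T : Type u) (_ : AddCommGroup T) (_ : Module A T), GDimZero A T ∧
        ∃ f : T →ₗ[A] M, Function.Surjective f ∧ GDimLE A n (LinearMap.ker f)

/-! ## Complexity -/

/-- The length of a module: the length of the longest chain in its lattice of submodules.
For a module annihilated by the maximal ideal (such as `Tor_n^A(M, k)`) this is its
dimension as a `k`-vector space. -/
noncomputable def moduleLength (A : Type u) [CommRing A]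
    (M : Type u) [AddCommGroup M] [Module A M] : WithBot ℕ∞ :=
  Order.krullDim (Submodule A M)

/-- `cx_A(M) ≤ c`: there exists a real `α` with
`dim_k Tor_n^A(M, k) ≤ α n^(c-1)` for all `n ≫ 0`. -/
def ComplexityLE (A : Type u) [CommRing A] [IsLocalRing A]
    (M : Type u) [AddCommGroup M] [Module A M] (c : ℕ) : Prop :=
  ∃ α : ℝ, ∃ n₀ : ℕ, ∀ n ≥ n₀, ∃ d : ℕ,
    moduleLength A
      (((Tor (ModuleCat.{u} A) n).obj (ModuleCat.of A M)).obj
        (ModuleCat.of A (ResidueField A))) = (d : ℕ∞) ∧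
      (d : ℝ) ≤ α * (n : ℝ) ^ ((c : ℤ) - 1)

/-- The complexity `cx_A(M)`: the least `c` as above. -/
noncomputable def complexity (A : Type u) [CommRing A] [IsLocalRing A]
    (M : Type u) [AddCommGroup M] [Module A M] : ℕ :=
  sInf {c : ℕ | ComplexityLE A M c}

/-- The embedding dimension `dim_k m/m²` of a local ring. -/
noncomputable def embDim (A : Type u) [CommRing A] [IsLocalRing A] : ℕ :=
  Module.finrank (ResidueField A) (CotangentSpace A)


/-! ## Auxiliary elementary theory of `Tor` -/

namespace TorAux

open TensorProduct

/-- Diagram lemma behind the balancing of `Tor₁`. -/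
theorem nineLemma {R : Type*} [CommRing R]
    {LK LF LN GK GF GN MK MF : Type*}
    [AddCommGroup LK] [AddCommGroup LF] [AddCommGroup LN] [AddCommGroup GK] [AddCommGroup GF]
    [AddCommGroup GN] [AddCommGroup MK] [AddCommGroup MF]
    [Module R LK] [Module R LF] [Module R LN] [Module R GK] [Module R GF] [Module R GN]
    [Module R MK] [Module R MF]
    (a : LK →ₗ[R] LF) (b : LF →ₗ[R] LN) (c : GK →ₗ[R] GF) (d : GF →ₗ[R] GN) (e : MK →ₗ[R] MF)
    (u1 : LK →ₗ[R] GK) (v1 : GK →ₗ[R] MK) (u2 : LF →ₗ[R] GF) (v2 : GF →ₗ[R] MF)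
    (u3 : LN →ₗ[R] GN)
    (hab : Function.Exact a b) (hb : Function.Surjective b)
    (hcd : Function.Exact c d) (hc : Function.Injective c)
    (hv : Function.Exact u1 v1) (hv1 : Function.Surjective v1)
    (hv2 : Function.Exact u2 v2) (hu2 : Function.Injective u2)
    (s1 : ∀ z, u2 (a z) = c (u1 z)) (s2 : ∀ z, u3 (b z) = d (u2 z))
    (s3 : ∀ z, e (v1 z) = v2 (c z)) :
    Nonempty (LinearMap.ker e ≃ₗ[R] LinearMap.ker u3) := by
  let W : Submodule R (LF × GK) :=
    LinearMap.ker ((u2 ∘ₗ LinearMap.fst R LF GK) - (c ∘ₗ LinearMap.snd R LF GK))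
  have hW : ∀ w : W, u2 w.1.1 = c w.1.2 := by
    rintro ⟨⟨w, y⟩, h⟩
    simpa [W, sub_eq_zero] using h
  let φ : W →ₗ[R] LinearMap.ker e :=
    LinearMap.codRestrict _ (v1 ∘ₗ LinearMap.snd R LF GK ∘ₗ W.subtype) (by
      intro w
      simp only [LinearMap.coe_comp, Function.comp_apply, LinearMap.mem_ker, s3]
      have := hW w
      simp only [Submodule.subtype_apply, LinearMap.snd_apply]
      rw [← this]
      exact hv2.apply_apply_eq_zero _)
  let ψ : W →ₗ[R] LinearMap.ker u3 :=
    LinearMap.codRestrict _ (b ∘ₗ LinearMap.fst R LF GK ∘ₗ W.subtype) (by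
      intro w
      simp only [LinearMap.coe_comp, Function.comp_apply, LinearMap.mem_ker, s2]
      have := hW w
      simp only [Submodule.subtype_apply, LinearMap.fst_apply]
      rw [this]
      exact hcd.apply_apply_eq_zero _)
  have hφ : Function.Surjective φ := by
    rintro ⟨t, ht⟩
    obtain ⟨y, rfl⟩ := hv1 t
    rw [LinearMap.mem_ker, s3] at ht
    obtain ⟨w, hw⟩ := (hv2 _).1 ht
    refine ⟨⟨(w, y), by simp [W, hw]⟩, ?_⟩
    ext; rfl
  have hψ : Function.Surjective ψ := by
    rintro ⟨t, ht⟩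
    obtain ⟨w, rfl⟩ := hb t
    rw [LinearMap.mem_ker, s2] at ht
    obtain ⟨y, hy⟩ := (hcd _).1 ht
    refine ⟨⟨(w, y), by simp [W, hy]⟩, ?_⟩
    ext; rfl
  have hk : LinearMap.ker φ = LinearMap.ker ψ := by
    ext w
    have h := hW w
    have e1 : w ∈ LinearMap.ker φ ↔ v1 w.1.2 = 0 := by
      rw [LinearMap.mem_ker, Subtype.ext_iff]; rfl
    have e2 : w ∈ LinearMap.ker ψ ↔ b w.1.1 = 0 := by
      rw [LinearMap.mem_ker, Subtype.ext_iff]; rfl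
    rw [e1, e2]
    constructor
    · intro hy
      obtain ⟨z, hz⟩ := (hv _).1 hy
      rw [← hz, ← s1] at h
      rw [hu2 h]
      exact hab.apply_apply_eq_zero _
    · intro hy
      obtain ⟨z, hz⟩ := (hab _).1 hy
      rw [← hz, s1] at h
      rw [← hc h]
      exact hv.apply_apply_eq_zero _
  exact ⟨(φ.quotKerEquivOfSurjective hφ).symm.trans
    ((Submodule.quotEquivOfEq _ _ hk).trans (ψ.quotKerEquivOfSurjective hψ))⟩

/-- A short exact sequence `0 → K → F → N → 0`. -/
structure SES {R : Type u} [CommRing R] {K F N : Type u} [AddCommGroup K] [AddCommGroup F]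
    [AddCommGroup N] [Module R K] [Module R F] [Module R N]
    (i : K →ₗ[R] F) (p : F →ₗ[R] N) : Prop where
  inj : Function.Injective i
  exact : Function.Exact i p
  surj : Function.Surjective p

section

variable {R : Type u} [CommRing R]
  {K F N : Type u} [AddCommGroup K] [AddCommGroup F] [AddCommGroup N]
  [Module R K] [Module R F] [Module R N] {i : K →ₗ[R] F} {p : F →ₗ[R] N}
  {L G X : Type u} [AddCommGroup L] [AddCommGroup G] [AddCommGroup X]
  [Module R L] [Module R G] [Module R X] {j : L →ₗ[R] G} {q : G →ₗ[R] X}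

theorem balance [Module.Flat R F] [Module.Flat R G] (h : SES i p) (h' : SES j q) :
    Nonempty (LinearMap.ker (i.lTensor X) ≃ₗ[R] LinearMap.ker (j.rTensor N)) := by
  refine nineLemma (i.lTensor L) (p.lTensor L) (i.lTensor G) (p.lTensor G) (i.lTensor X)
    (j.rTensor K) (q.rTensor K) (j.rTensor F) (q.rTensor F) (j.rTensor N)
    (lTensor_exact L h.exact h.surj) (LinearMap.lTensor_surjective L h.surj)
    (lTensor_exact G h.exact h.surj) (Module.Flat.lTensor_preserves_injective_linearMap _ h.inj)
    (rTensor_exact K h'.exact h'.surj) (LinearMap.rTensor_surjective K h'.surj)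
    (rTensor_exact F h'.exact h'.surj)
    (Module.Flat.rTensor_preserves_injective_linearMap _ h'.inj) ?_ ?_ ?_
  all_goals
    intro z
    simp only [← LinearMap.comp_apply, LinearMap.rTensor_comp_lTensor,
      LinearMap.lTensor_comp_rTensor]

/-- Both kernels are the kernel of `L ⊗ K → G ⊗ F`. -/
theorem ker_eq [Module.Flat R F] [Module.Flat R G] (h : SES i p) (h' : SES j q) :
    LinearMap.ker (i.lTensor L) = LinearMap.ker (j.rTensor K) := by
  have h1 : Function.Injective (j.rTensor F) :=
    Module.Flat.rTensor_preserves_injective_linearMap _ h'.inj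
  have h2 : Function.Injective (i.lTensor G) :=
    Module.Flat.lTensor_preserves_injective_linearMap _ h.inj
  ext z
  have : j.rTensor F (i.lTensor L z) = i.lTensor G (j.rTensor K z) := by
    simp only [← LinearMap.comp_apply, LinearMap.rTensor_comp_lTensor,
      LinearMap.lTensor_comp_rTensor]
  rw [LinearMap.mem_ker, LinearMap.mem_ker]
  constructor
  · intro hz
    rw [hz, map_zero] at this
    exact h2 (by rw [← this, map_zero])
  · intro hz
    rw [hz, map_zero] at this
    exact h1 (by rw [this, map_zero])

theorem inj_iff_of_equiv {R U V U' V' : Type*} [CommRing R] [AddCommGroup U] [AddCommGroup V]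
    [AddCommGroup U'] [AddCommGroup V'] [Module R U] [Module R V] [Module R U'] [Module R V']
    {f : U →ₗ[R] V} {g : U' →ₗ[R] V'}
    (e : Nonempty (LinearMap.ker f ≃ₗ[R] LinearMap.ker g)) :
    Function.Injective f ↔ Function.Injective g := by
  obtain ⟨e⟩ := e
  rw [← LinearMap.ker_eq_bot, ← LinearMap.ker_eq_bot, ← Submodule.subsingleton_iff_eq_bot,
    ← Submodule.subsingleton_iff_eq_bot]
  exact e.toEquiv.subsingleton_congr

theorem balance_inj [Module.Flat R F] [Module.Flat R G] (h : SES i p) (h' : SES j q) :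
    Function.Injective (i.lTensor X) ↔ Function.Injective (j.rTensor N) :=
  inj_iff_of_equiv (balance h h')

end

theorem SES.ofSurj {R K F : Type u} [CommRing R] [AddCommGroup K] [AddCommGroup F]
    [Module R K] [Module R F] (p : F →ₗ[R] K) (hp : Function.Surjective p) :
    SES (LinearMap.ker p).subtype p where
  inj := Subtype.val_injective
  exact := LinearMap.exact_subtype_ker_map p
  surj := hp

section

variable (R M : Type u) [CommRing R] [AddCommGroup M] [Module R M]

/-- The canonical free module covering `M`. -/
def Fr : Type u := M →₀ R

noncomputable instance : AddCommGroup (Fr R M) := inferInstanceAs (AddCommGroup (M →₀ R))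

noncomputable instance : Module R (Fr R M) := inferInstanceAs (Module R (M →₀ R))

instance : Module.Free R (Fr R M) := inferInstanceAs (Module.Free R (M →₀ R))

/-- The canonical free cover. -/
noncomputable def cov : Fr R M →ₗ[R] M := Finsupp.linearCombination R (id : M → M)

theorem cov_surj : Function.Surjective (cov R M) :=
  fun m => ⟨Finsupp.single m (1 : R), (Finsupp.linearCombination_single R 1 m).trans (by simp)⟩

/-- The canonical first syzygy. -/
def Syz : Type u := LinearMap.ker (cov R M)

noncomputable instance : AddCommGroup (Syz R M) :=
  inferInstanceAs (AddCommGroup (LinearMap.ker (cov R M)))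

noncomputable instance : Module R (Syz R M) :=
  inferInstanceAs (Module R (LinearMap.ker (cov R M)))

/-- The inclusion of the syzygy. -/
noncomputable def inc : Syz R M →ₗ[R] Fr R M := (LinearMap.ker (cov R M)).subtype

theorem canon : SES (inc R M) (cov R M) := SES.ofSurj (cov R M) (cov_surj R M)

end

/-- `TorInj R j X N` says that `Tor_{j+1}^R(X, N) = 0`. -/
def TorInj (R : Type u) [CommRing R] :
    ℕ → ∀ (X N : Type u) [AddCommGroup X] [Module R X] [AddCommGroup N] [Module R N], Prop
  | 0 => fun X N _ _ _ _ => Function.Injective ((inc R X).rTensor N)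
  | j + 1 => fun X N _ _ _ _ => TorInj R j (Syz R X) N

section

variable {R : Type u} [CommRing R]
  {K F N : Type u} [AddCommGroup K] [AddCommGroup F] [AddCommGroup N]
  [Module R K] [Module R F] [Module R N] {i : K →ₗ[R] F} {p : F →ₗ[R] N}

theorem torInj_zero_iff [Module.Flat R F] (h : SES i p) (X : Type u) [AddCommGroup X]
    [Module R X] : TorInj R 0 X N ↔ Function.Injective (i.lTensor X) :=
  (balance_inj h (canon R X)).symm

theorem torInj_zero_iff' [Module.Flat R F] (h : SES i p) (X : Type u) [AddCommGroup X]
    [Module R X] : TorInj R 0 N X ↔ Function.Injective (i.rTensor X) :=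
  (torInj_zero_iff (canon R X) N).trans (balance_inj (canon R X) h)

theorem torInj_succ_iff [Module.Flat R F] (h : SES i p) (j : ℕ) (X : Type u) [AddCommGroup X]
    [Module R X] : TorInj R (j + 1) X N ↔ TorInj R j X K := by
  induction j generalizing X with
  | zero =>
    show TorInj R 0 (Syz R X) N ↔ Function.Injective ((inc R X).rTensor K)
    rw [torInj_zero_iff h, ← LinearMap.ker_eq_bot, ← LinearMap.ker_eq_bot,
      ker_eq h (canon R X)]
  | succ j ih => exact ih (Syz R X)

end

theorem flatDim_torInj {R : Type u} [CommRing R] (n : ℕ) (N : Type u) [AddCommGroup N]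
    [Module R N] (h : FlatDimLE R n N) (X : Type u) [AddCommGroup X] [Module R X] (m : ℕ)
    (hm : n ≤ m) : TorInj R m X N := by
  induction n generalizing N m X with
  | zero =>
    have : Module.Flat R N := h
    clear hm
    induction m generalizing X with
    | zero => exact Module.Flat.rTensor_preserves_injective_linearMap _ (canon R X).inj
    | succ m ih => exact ih _
  | succ n ih =>
    obtain ⟨F, _, _, hF, f, hf, hk⟩ := h
    obtain ⟨m, rfl⟩ : ∃ m', m = m' + 1 := ⟨m - 1, by omega⟩
    rw [torInj_succ_iff (SES.ofSurj f hf)]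
    exact ih _ hk _ _ (by omega)

theorem flatDim_of_torInj {R : Type u} [CommRing R] (n : ℕ) (N : Type u) [AddCommGroup N]
    [Module R N] (h : ∀ I : Ideal R, TorInj R n (R ⧸ I) N) : FlatDimLE R n N := by
  induction n generalizing N with
  | zero =>
    show Module.Flat R N
    rw [Module.Flat.iff_rTensor_injective']
    intro I
    have hs : SES (I.subtype) (I.mkQ) :=
      ⟨Subtype.val_injective, LinearMap.exact_subtype_mkQ I, I.mkQ_surjective⟩
    exact (torInj_zero_iff' hs N).1 (h I)
  | succ n ih =>
    refine ⟨(Fr R N), inferInstance, inferInstance, inferInstance, cov R N, (canon R N).surj, ?_⟩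
    exact ih _ fun I => (torInj_succ_iff (canon R N) n _).1 (h I)

section LES

variable {R : Type u} [CommRing R]
  {C' C C'' : Type u} [AddCommGroup C'] [AddCommGroup C] [AddCommGroup C'']
  [Module R C'] [Module R C] [Module R C''] {f : C' →ₗ[R] C} {g : C →ₗ[R] C''}

theorem tensor_comm {A B C D : Type*} [AddCommGroup A] [AddCommGroup B] [AddCommGroup C]
    [AddCommGroup D] [Module R A] [Module R B] [Module R C] [Module R D]
    (f : A →ₗ[R] B) (g : C →ₗ[R] D) (z : A ⊗[R] C) :
    f.rTensor D (g.lTensor A z) = g.lTensor B (f.rTensor C z) := by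
  simp only [← LinearMap.comp_apply, LinearMap.rTensor_comp_lTensor,
      LinearMap.lTensor_comp_rTensor]

theorem torInj_mid (h : SES f g) (j : ℕ) (N : Type u) [AddCommGroup N] [Module R N]
    (h1 : TorInj R j C' N) (h2 : TorInj R j C'' N) : TorInj R j C N := by
  induction j generalizing N with
  | zero =>
    rw [torInj_zero_iff (canon R N)] at h1 h2 ⊢
    rw [injective_iff_map_eq_zero] at h1 h2 ⊢
    intro t ht
    have : g.rTensor _ t = 0 := h2 _ (by rw [← tensor_comm, ht, map_zero])
    obtain ⟨s, rfl⟩ := (rTensor_exact _ h.exact h.surj _).1 this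
    rw [← tensor_comm] at ht
    rw [h1 s, map_zero]
    exact Module.Flat.rTensor_preserves_injective_linearMap _ h.inj (by rw [ht, map_zero])
  | succ j ih =>
    rw [torInj_succ_iff (canon R N)] at h1 h2 ⊢
    exact ih _ h1 h2

theorem torInj_right (h : SES f g) (j : ℕ) (N : Type u) [AddCommGroup N] [Module R N]
    (h1 : TorInj R j C' N) (h2 : TorInj R (j + 1) C N) : TorInj R (j + 1) C'' N := by
  induction j generalizing N with
  | zero =>
    rw [torInj_zero_iff (canon R N)] at h1
    rw [torInj_succ_iff (canon R N)] at h2 ⊢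
    rw [torInj_zero_iff (canon R _)] at h2 ⊢
    have h0 : Function.Injective (f.rTensor (Syz R N)) := by
      have : Function.Injective (f.rTensor (Fr R N)) :=
        Module.Flat.rTensor_preserves_injective_linearMap _ h.inj
      have := this.comp h1
      intro a b hab
      apply this
      simp only [Function.comp_apply, tensor_comm, hab]
    rw [injective_iff_map_eq_zero]
    intro t ht
    obtain ⟨u, rfl⟩ := LinearMap.rTensor_surjective _ h.surj t
    rw [← tensor_comm] at ht
    obtain ⟨w, hw⟩ := (rTensor_exact _ h.exact h.surj _).1 ht
    have hw0 : (cov R (Syz R N)).lTensor C' w = 0 := by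
      apply h0
      rw [tensor_comm, hw, map_zero]
      exact (lTensor_exact C (canon R (Syz R N)).exact
        (canon R (Syz R N)).surj).apply_apply_eq_zero _
    obtain ⟨z, rfl⟩ := (lTensor_exact C' (canon R (Syz R N)).exact
        (canon R (Syz R N)).surj _).1 hw0
    rw [tensor_comm] at hw
    rw [← h2 hw]
    exact (rTensor_exact _ h.exact h.surj).apply_apply_eq_zero _
  | succ j ih =>
    rw [torInj_succ_iff (canon R N)] at h1 h2 ⊢
    exact ih _ h1 h2

theorem torInj_subsingleton [Subsingleton C] (j : ℕ) (N : Type u) [AddCommGroup N]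
    [Module R N] : TorInj R j C N := by
  induction j generalizing N with
  | zero =>
    rw [torInj_zero_iff (canon R N)]
    exact Function.injective_of_subsingleton _
  | succ j ih =>
    rw [torInj_succ_iff (canon R N)]
    exact ih _

theorem torInj_equiv (e : C ≃ₗ[R] C') (j : ℕ) (N : Type u) [AddCommGroup N] [Module R N]
    (h : TorInj R j C N) : TorInj R j C' N := by
  have hs : SES (e : C →ₗ[R] C') (0 : C' →ₗ[R] PUnit.{u+1}) := by
    refine ⟨e.injective, ?_, fun x => ⟨0, rfl⟩⟩
    intro y
    simp only [LinearMap.zero_apply, true_iff]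
    exact ⟨e.symm y, by simp⟩
  exact torInj_mid hs j N h (torInj_subsingleton j N)

end LES

end TorAux

namespace TorAux

open TensorProduct

theorem torInj_iff_exact {R : Type u} [CommRing R] (M : Type u) [AddCommGroup M] [Module R M]
    (j : ℕ) (N : Type u) [AddCommGroup N] [Module R N]
    (P : ℕ → Type u) [∀ n, AddCommGroup (P n)] [∀ n, Module R (P n)] [∀ n, Module.Flat R (P n)]
    (d : ∀ n, P (n + 1) →ₗ[R] P n) (π : P 0 →ₗ[R] N) (hπ : Function.Surjective π)
    (h0 : Function.Exact (d 0) π) (hd : ∀ n, Function.Exact (d (n + 1)) (d n)) :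
    TorInj R j M N ↔ Function.Exact ((d (j + 1)).lTensor M) ((d j).lTensor M) := by
  induction j generalizing N P with
  | zero =>
    let d' : P 1 →ₗ[R] LinearMap.ker π :=
      (d 0).codRestrict _ (fun x => h0.apply_apply_eq_zero x)
    have hd' : (LinearMap.ker π).subtype ∘ₗ d' = d 0 := rfl
    have hd's : Function.Surjective d' := by
      rintro ⟨x, hx⟩
      obtain ⟨y, rfl⟩ := (h0 x).1 hx
      exact ⟨y, rfl⟩
    have hex : Function.Exact (d 1) d' := by
      intro x
      rw [← hd 0 x, Subtype.ext_iff]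
      rfl
    have hex' := lTensor_exact M hex hd's
    rw [torInj_zero_iff (SES.ofSurj π hπ)]
    have hc : ∀ x, (d 0).lTensor M x = (LinearMap.ker π).subtype.lTensor M (d'.lTensor M x) := by
      intro x
      rw [← LinearMap.comp_apply, ← LinearMap.lTensor_comp, hd']
    constructor
    · intro hi x
      show (d 0).lTensor M x = 0 ↔ _
      rw [← hex' x, hc, map_eq_zero_iff _ hi]
    · intro he
      rw [injective_iff_map_eq_zero]
      intro t ht
      obtain ⟨x, rfl⟩ := LinearMap.lTensor_surjective M hd's t
      rw [← hc] at ht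
      exact (hex' x).2 ((he x).1 ht)
  | succ j ih =>
    rw [torInj_succ_iff (SES.ofSurj π hπ)]
    refine ih (LinearMap.ker π) (fun n => P (n + 1)) (fun n => d (n + 1))
      ((d 0).codRestrict _ (fun x => h0.apply_apply_eq_zero x)) ?_ ?_ (fun n => hd (n + 1))
    · rintro ⟨x, hx⟩
      obtain ⟨y, rfl⟩ := (h0 x).1 hx
      exact ⟨y, rfl⟩
    · intro x
      rw [← hd 0 x, Subtype.ext_iff]
      rfl

theorem torVanish_iff {R : Type u} [CommRing R] (M : Type u) [AddCommGroup M] [Module R M]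
    (j : ℕ) (N : Type u) [AddCommGroup N] [Module R N] :
    TorVanish R (j + 1) M N ↔ TorInj R j M N := by
  let P := ProjectiveResolution.of (ModuleCat.of R N)
  have hP : ∀ n, Module.Flat R (P.complex.X n) := fun n => by
    have : Module.Projective R (P.complex.X n) :=
      (IsProjective.iff_projective (P.complex.X n)).2 (P.projective n)
    infer_instance
  have hs : Function.Surjective (P.π.f 0).hom :=
    (ModuleCat.epi_iff_surjective _).1 inferInstance
  have h0 : Function.Exact (P.complex.d 1 0).hom (P.π.f 0).hom :=
    (ShortComplex.ShortExact.moduleCat_exact_iff_function_exact _).1 P.exact₀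
  have hd : ∀ n, Function.Exact (P.complex.d (n + 2) (n + 1)).hom (P.complex.d (n + 1) n).hom :=
    fun n => (ShortComplex.ShortExact.moduleCat_exact_iff_function_exact _).1 (P.exact_succ n)
  let π : P.complex.X 0 →ₗ[R] N := (P.π.f 0).hom
  refine Iff.trans ?_ (torInj_iff_exact M j N (fun n => P.complex.X n)
    (fun n => (P.complex.d (n + 1) n).hom) π hs h0 hd).symm
  let F := (MonoidalCategory.tensoringLeft (ModuleCat.{u} R)).obj (ModuleCat.of R M)
  let C := (F.mapHomologicalComplex (ComplexShape.down ℕ)).obj P.complex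
  have e : ((Tor (ModuleCat.{u} R) (j + 1)).obj (ModuleCat.of R M)).obj (ModuleCat.of R N) ≅
    C.homology (j + 1) := P.isoLeftDerivedObj F (j + 1)
  unfold TorVanish
  rw [e.toLinearEquiv.toEquiv.subsingleton_congr, ← ModuleCat.isZero_iff_subsingleton,
    ← HomologicalComplex.exactAt_iff_isZero_homology,
    HomologicalComplex.exactAt_iff' C (j + 2) (j + 1) j (by simp) (by simp),
    ShortComplex.ShortExact.moduleCat_exact_iff_function_exact]
  rfl

section baseChange

variable {A A' : Type u} [CommRing A] [CommRing A'] [Algebra A A']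

theorem baseChange_inj_iff (M : Type u) [AddCommGroup M] [Module A M]
    {K F : Type u} [AddCommGroup K] [AddCommGroup F] [Module A' K] [Module A' F]
    [Module A K] [Module A F] [IsScalarTower A A' K] [IsScalarTower A A' F] (i : K →ₗ[A'] F) :
    Function.Injective (i.lTensor (A' ⊗[A] M)) ↔
      Function.Injective ((i.restrictScalars A).lTensor M) := by
  rw [LinearMap.lTensor_inj_iff_rTensor_inj, LinearMap.lTensor_inj_iff_rTensor_inj]
  let e1 := AlgebraTensorModule.cancelBaseChange A A' A' K M
  let e2 := AlgebraTensorModule.cancelBaseChange A A' A' F M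
  have h : ∀ x, e2 (i.rTensor _ x) = (i.restrictScalars A).rTensor M (e1 x) := by
    intro x
    induction x with
    | zero => simp
    | add x y hx hy => rw [map_add, map_add, map_add, map_add, hx, hy]
    | tmul k y =>
      induction y with
      | zero => simp
      | add x y hx hy => rw [tmul_add, map_add, map_add, map_add, map_add, hx, hy]
      | tmul a m => simp [e1, e2]
  have h2 : e2 ∘ (i.rTensor (A' ⊗[A] M)) = (i.restrictScalars A).rTensor M ∘ e1 := funext h
  rw [← e2.injective.of_comp_iff, h2]
  exact Function.Injective.of_comp_iff' _ e1.bijective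

theorem torInj_baseChange [Module.Flat A A'] (M : Type u) [AddCommGroup M] [Module A M]
    (j : ℕ) (N : Type u) [AddCommGroup N] [Module A' N] [Module A N] [IsScalarTower A A' N] :
    TorInj A' j (A' ⊗[A] M) N ↔ TorInj A j M N := by
  induction j generalizing N with
  | zero =>
    let _ : Module A (Fr A' N) := Module.compHom _ (algebraMap A A')
    let _ : Module A (Syz A' N) := Module.compHom _ (algebraMap A A')
    have : IsScalarTower A A' (Fr A' N) := IsScalarTower.of_algebraMap_smul fun _ _ => rfl
    have : IsScalarTower A A' (Syz A' N) := IsScalarTower.of_algebraMap_smul fun _ _ => rfl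
    have : Module.Flat A (Fr A' N) := Module.Flat.trans A A' _
    have hs : SES ((inc A' N).restrictScalars A) ((cov A' N).restrictScalars A) :=
      ⟨(canon A' N).inj, (canon A' N).exact, (canon A' N).surj⟩
    rw [torInj_zero_iff (canon A' N), torInj_zero_iff hs, baseChange_inj_iff]
  | succ j ih =>
    let _ : Module A (Fr A' N) := Module.compHom _ (algebraMap A A')
    let _ : Module A (Syz A' N) := Module.compHom _ (algebraMap A A')
    have : IsScalarTower A A' (Fr A' N) := IsScalarTower.of_algebraMap_smul fun _ _ => rfl
    have : IsScalarTower A A' (Syz A' N) := IsScalarTower.of_algebraMap_smul fun _ _ => rfl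
    have : Module.Flat A (Fr A' N) := Module.Flat.trans A A' _
    have hs : SES ((inc A' N).restrictScalars A) ((cov A' N).restrictScalars A) :=
      ⟨(canon A' N).inj, (canon A' N).exact, (canon A' N).surj⟩
    rw [torInj_succ_iff (canon A' N), torInj_succ_iff hs, ih]

end baseChange

end TorAux

namespace TorAux

open TensorProduct

section Nak

/-- Nakayama property for the kernel of a linear map. -/
def NakM {R U V : Type*} [CommRing R] [IsLocalRing R] [AddCommGroup U] [AddCommGroup V]
    [Module R U] [Module R V] (f : U →ₗ[R] V) : Prop :=
  ∀ x ∈ maximalIdeal R, (∀ t, f t = 0 → ∃ s, f s = 0 ∧ t = x • s) → ∀ t, f t = 0 → t = 0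

theorem NakM.of_equiv {R U V U' V' : Type*} [CommRing R] [IsLocalRing R] [AddCommGroup U]
    [AddCommGroup V] [AddCommGroup U'] [AddCommGroup V'] [Module R U] [Module R V] [Module R U']
    [Module R V'] {f : U →ₗ[R] V} {g : U' →ₗ[R] V'}
    (e : Nonempty (LinearMap.ker f ≃ₗ[R] LinearMap.ker g)) (hg : NakM g) : NakM f := by
  obtain ⟨e⟩ := e
  intro x hx h t ht
  have key := hg x hx (by
    intro t ht
    obtain ⟨s, hs, hts⟩ := h (e.symm ⟨t, ht⟩).1 (e.symm ⟨t, ht⟩).2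
    refine ⟨(e ⟨s, hs⟩).1, (e ⟨s, hs⟩).2, ?_⟩
    have : e.symm ⟨t, ht⟩ = x • (⟨s, hs⟩ : LinearMap.ker f) := Subtype.ext hts
    have := congrArg e this
    rw [e.apply_symm_apply, map_smul] at this
    exact congrArg Subtype.val this)
  have h0 := key (e ⟨t, ht⟩).1 (e ⟨t, ht⟩).2
  have h1 : e ⟨t, ht⟩ = 0 := Subtype.ext h0
  rw [map_eq_zero_iff e e.injective] at h1
  exact congrArg Subtype.val h1

variable {R : Type u} [CommRing R] [IsLocalRing R] [IsNoetherianRing R]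

/-- All `Tor_1(C, N)` with `C` finite satisfy Nakayama. -/
def PN (R : Type u) [CommRing R] [IsLocalRing R] (N : Type u) [AddCommGroup N]
    [Module R N] : Prop :=
  ∀ (C : Type u) [AddCommGroup C] [Module R C], Module.Finite R C →
    NakM ((inc R N).lTensor C)

theorem PN.syz (N : Type u) [AddCommGroup N] [Module R N] (h : PN R N) : PN R (Syz R N) := by
  intro C _ _ hC
  obtain ⟨n, q, hq⟩ := Module.Finite.exists_fin' R C
  have hs := SES.ofSurj q hq
  have e := balance (canon R (Syz R N)) hs
  rw [← ker_eq (canon R N) hs] at e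
  exact NakM.of_equiv e (h _ inferInstance)

theorem nakM_of_finite {B N : Type u} [CommRing B] [IsLocalRing B] [IsNoetherianRing B]
    [Algebra R B] (hB : IsLocalHom (algebraMap R B)) [AddCommGroup N] [Module R N] [Module B N]
    [IsScalarTower R B N] (hN : Module.Finite B N) {L G : Type u} [AddCommGroup L]
    [AddCommGroup G] [Module R L] [Module R G] [Module.Finite R L] (j : L →ₗ[R] G) :
    NakM (j.rTensor N) := by
  intro x hx h
  let J : Submodule B (N ⊗[R] L) := LinearMap.ker (AlgebraTensorModule.lTensor B N j)
  have hJ : ∀ t, t ∈ J ↔ j.rTensor N (TensorProduct.comm R N L t) = 0 := by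
    intro t
    have : TensorProduct.comm R N G (AlgebraTensorModule.lTensor B N j t) =
        j.rTensor N (TensorProduct.comm R N L t) := by
      induction t with
      | zero => simp
      | add a b ha hb => simp only [map_add, ha, hb]
      | tmul a b => simp
    rw [← this, EmbeddingLike.map_eq_zero_iff]
    rfl
  have hfin : Module.Finite B (N ⊗[R] L) := by
    obtain ⟨n, q, hq⟩ := Module.Finite.exists_fin' R L
    have h1 : Module.Finite B (N ⊗[R] (Fin n → R)) :=
      Module.Finite.equiv (TensorProduct.piScalarRight R B N (Fin n)).symm
    exact Module.Finite.of_surjective (AlgebraTensorModule.lTensor B N q)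
      (LinearMap.lTensor_surjective N hq)
  have hfg : J.FG := IsNoetherian.noetherian J
  have hbot : J = ⊥ := by
    refine Submodule.eq_bot_of_le_smul_of_le_jacobson_bot (Ideal.span {algebraMap R B x}) J hfg
      ?_ ?_
    · intro t ht
      obtain ⟨s, hs, hts⟩ := h _ ((hJ t).1 ht)
      have h2 : t = algebraMap R B x • (TensorProduct.comm R N L).symm s := by
        rw [algebraMap_smul, ← map_smul, ← hts, LinearEquiv.symm_apply_apply]
      rw [h2]
      refine Submodule.smul_mem_smul (Ideal.mem_span_singleton_self _) ?_
      rw [hJ, LinearEquiv.apply_symm_apply, hs]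
    · rw [IsLocalRing.jacobson_eq_maximalIdeal _ bot_ne_top, Ideal.span_singleton_le_iff_mem]
      exact map_nonunit (algebraMap R B) x hx
  intro t ht
  have : (TensorProduct.comm R N L).symm t ∈ J := by
    rw [hJ, LinearEquiv.apply_symm_apply, ht]
  rw [hbot, Submodule.mem_bot, EmbeddingLike.map_eq_zero_iff] at this
  exact this

theorem PN.of_finite {B N : Type u} [CommRing B] [IsLocalRing B] [IsNoetherianRing B]
    [Algebra R B] (hB : IsLocalHom (algebraMap R B)) [AddCommGroup N] [Module R N] [Module B N]
    [IsScalarTower R B N] (hN : Module.Finite B N) : PN R N := by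
  intro C _ _ hC
  obtain ⟨n, q, hq⟩ := Module.Finite.exists_fin' R C
  have hs := SES.ofSurj q hq
  exact NakM.of_equiv (balance (canon R N) hs) (nakM_of_finite hB hN _)

theorem primeSES (I : Ideal R) (hI : I.IsPrime) (x : R) (hx : x ∉ I) :
    SES (x • LinearMap.id : (R ⧸ I) →ₗ[R] (R ⧸ I))
      (Submodule.factor (le_sup_left : I ≤ I ⊔ Ideal.span {x})) where
  inj := by
    rw [injective_iff_map_eq_zero]
    intro a ha
    obtain ⟨a, rfl⟩ := Ideal.Quotient.mk_surjective a
    have : Ideal.Quotient.mk I (x * a) = 0 := ha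
    rw [Ideal.Quotient.eq_zero_iff_mem] at this ⊢
    exact (hI.mem_or_mem this).resolve_left hx
  exact := by
    intro a
    obtain ⟨a, rfl⟩ := Ideal.Quotient.mk_surjective a
    have h1 : Submodule.factor (le_sup_left : I ≤ I ⊔ Ideal.span {x}) (Ideal.Quotient.mk I a) =
      Ideal.Quotient.mk (I ⊔ Ideal.span {x}) a := rfl
    rw [h1, Ideal.Quotient.eq_zero_iff_mem, Submodule.mem_sup]
    constructor
    · rintro ⟨y, hy, z, hz, rfl⟩
      obtain ⟨c, rfl⟩ := Ideal.mem_span_singleton.1 hz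
      refine ⟨Ideal.Quotient.mk I c, ?_⟩
      rw [map_add, Ideal.Quotient.eq_zero_iff_mem.2 hy, zero_add]
      rfl
    · rintro ⟨c, hc⟩
      obtain ⟨c, rfl⟩ := Ideal.Quotient.mk_surjective c
      have hc' : Ideal.Quotient.mk I (x * c) = Ideal.Quotient.mk I a := hc
      rw [eq_comm, Ideal.Quotient.eq] at hc'
      exact ⟨_, hc', x * c, Ideal.mem_span_singleton.2 ⟨c, rfl⟩, by ring⟩
  surj := Submodule.factor_surjective _

theorem colonSES (I : Ideal R) (x : R) :
    SES ((LinearMap.ker (LinearMap.toSpanSingleton R (R ⧸ I) (Ideal.Quotient.mk I x))).liftQ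
        (LinearMap.toSpanSingleton R (R ⧸ I) (Ideal.Quotient.mk I x)) le_rfl)
      (Submodule.factor (le_sup_left : I ≤ I ⊔ Ideal.span {x})) where
  inj := by
    rw [← LinearMap.ker_eq_bot]
    exact Submodule.ker_liftQ_eq_bot' _ _ rfl
  exact := by
    intro a
    obtain ⟨a, rfl⟩ := Ideal.Quotient.mk_surjective a
    have h1 : Submodule.factor (le_sup_left : I ≤ I ⊔ Ideal.span {x}) (Ideal.Quotient.mk I a) =
      Ideal.Quotient.mk (I ⊔ Ideal.span {x}) a := rfl
    rw [h1, Ideal.Quotient.eq_zero_iff_mem, Submodule.mem_sup]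
    constructor
    · rintro ⟨y, hy, z, hz, rfl⟩
      obtain ⟨c, rfl⟩ := Ideal.mem_span_singleton.1 hz
      refine ⟨Submodule.Quotient.mk c, ?_⟩
      rw [map_add, Ideal.Quotient.eq_zero_iff_mem.2 hy, zero_add, mul_comm]
      rfl
    · rintro ⟨c, hc⟩
      obtain ⟨c, rfl⟩ := Submodule.Quotient.mk_surjective _ c
      have hc' : Ideal.Quotient.mk I (c * x) = Ideal.Quotient.mk I a := hc
      rw [eq_comm, Ideal.Quotient.eq] at hc'
      exact ⟨_, hc', c * x, Ideal.mem_span_singleton.2 ⟨c, mul_comm _ _⟩, by ring⟩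
  surj := Submodule.factor_surjective _

theorem torInj_zero_of_residue (N : Type u) [AddCommGroup N] [Module R N] (hN : PN R N)
    (hk : TorInj R 0 (R ⧸ maximalIdeal R) N) (I : Ideal R) : TorInj R 0 (R ⧸ I) N := by
  induction I using WellFoundedGT.induction with
  | ind I ih =>
  by_cases hI : I.IsPrime
  · by_cases hm : I = maximalIdeal R
    · rw [hm]; exact hk
    · obtain ⟨x, hx, hxI⟩ : ∃ x ∈ maximalIdeal R, x ∉ I := by
        by_contra! hcon
        exact hm (le_antisymm (IsLocalRing.le_maximalIdeal hI.ne_top) hcon)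
      have hs := primeSES I hI x hxI
      have hlt : I < I ⊔ Ideal.span {x} := by
        refine lt_of_le_of_ne le_sup_left fun h => hxI ?_
        rw [h]
        exact Ideal.mem_sup_right (Ideal.mem_span_singleton_self x)
      have h2 := ih _ hlt
      rw [torInj_zero_iff (canon R N)] at h2 ⊢
      rw [injective_iff_map_eq_zero] at h2 ⊢
      refine hN (R ⧸ I) inferInstance x hx ?_
      intro t ht
      have : (Submodule.factor (le_sup_left : I ≤ I ⊔ Ideal.span {x})).rTensor _ t = 0 :=
        h2 _ (by rw [← tensor_comm, ht, map_zero])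
      obtain ⟨s, rfl⟩ := (rTensor_exact _ hs.exact hs.surj _).1 this
      refine ⟨s, ?_, ?_⟩
      · rw [← tensor_comm] at ht
        exact Module.Flat.rTensor_preserves_injective_linearMap _ hs.inj (by rw [ht, map_zero])
      · rw [LinearMap.rTensor_smul, LinearMap.rTensor_id]; rfl
  · by_cases ht : I = ⊤
    · have : Subsingleton (R ⧸ I) := Ideal.Quotient.subsingleton_iff.2 ht
      exact torInj_subsingleton 0 N
    · obtain ⟨a, b, hab, ha, hb⟩ : ∃ a b, a * b ∈ I ∧ a ∉ I ∧ b ∉ I := by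
        by_contra! hcon
        refine hI ⟨ht, fun {a b} h => ?_⟩
        by_contra! h2
        exact h2.2 (hcon a b h h2.1)
      refine torInj_mid (colonSES I a) 0 N (ih _ ?_) (ih _ ?_)
      · have hmem : ∀ c, c ∈ LinearMap.ker (LinearMap.toSpanSingleton R (R ⧸ I)
            (Ideal.Quotient.mk I a)) ↔ c * a ∈ I := fun c => by
          rw [LinearMap.mem_ker, ← Ideal.Quotient.eq_zero_iff_mem]; rfl
        refine lt_of_le_of_ne (fun c hc => (hmem c).2 (I.mul_mem_right _ hc)) fun h => hb ?_
        rw [h, hmem, mul_comm]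
        exact hab
      · refine lt_of_le_of_ne le_sup_left fun h => ha ?_
        rw [h]
        exact Ideal.mem_sup_right (Ideal.mem_span_singleton_self a)

theorem torInj_of_residue (j : ℕ) (N : Type u) [AddCommGroup N] [Module R N] (hN : PN R N)
    (hk : TorInj R j (R ⧸ maximalIdeal R) N) (I : Ideal R) : TorInj R j (R ⧸ I) N := by
  induction j generalizing N with
  | zero => exact torInj_zero_of_residue N hN hk I
  | succ j ih =>
    rw [torInj_succ_iff (canon R N)] at hk ⊢
    exact ih _ hN.syz hk

end Nak

end TorAux

namespace TorAux

open TensorProduct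

theorem ringKrullDim_le_zero {R : Type u} [CommRing R] [IsLocalRing R] (I : Ideal R)
    (h : maximalIdeal R ∈ I.minimalPrimes) : ringKrullDim (R ⧸ I) ≤ 0 := by
  rw [ringKrullDim_quotient]
  have : Subsingleton (PrimeSpectrum.zeroLocus (R := R) I) := by
    refine ⟨fun p q => ?_⟩
    have key : ∀ p : PrimeSpectrum.zeroLocus (R := R) I, p.1.asIdeal = maximalIdeal R := by
      intro p
      have hp : I ≤ p.1.asIdeal := p.2
      refine le_antisymm (IsLocalRing.le_maximalIdeal p.1.2.ne_top) ?_
      exact h.2 ⟨p.1.2, hp⟩ (IsLocalRing.le_maximalIdeal p.1.2.ne_top)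
    exact Subtype.ext (PrimeSpectrum.ext ((key p).trans (key q).symm))
  exact Order.krullDim_nonpos_of_subsingleton

theorem regAux {R : Type u} [CommRing R] [IsLocalRing R] [IsNoetherianRing R] (d : ℕ)
    (I : Ideal R) (s : Finset R) (hs : maximalIdeal R = I ⊔ Ideal.span (s : Set R))
    (hc : s.card ≤ d) (hd : (d : WithBot ℕ∞) ≤ ringKrullDim (R ⧸ I)) :
    I.IsPrime ∧ ∀ (N : Type u) [AddCommGroup N] [Module R N] (n : ℕ),
      (∀ j ≥ n, TorInj R j (R ⧸ I) N) →
      ∃ n', ∀ j ≥ n', TorInj R j (R ⧸ maximalIdeal R) N := by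
  classical
  induction d generalizing I s with
  | zero =>
    have : s = ∅ := by simpa using hc
    subst this
    have hI : I = maximalIdeal R := by simpa using hs.symm
    subst hI
    exact ⟨inferInstance, fun N _ _ n h => ⟨n, h⟩⟩
  | succ d ih =>
    have hIm : I ≤ maximalIdeal R := by rw [hs]; exact le_sup_left
    have hmin : maximalIdeal R ∉ I.minimalPrimes := by
      intro h
      have h1 := hd.trans (ringKrullDim_le_zero I h)
      have : ((d + 1 : ℕ) : WithBot ℕ∞) ≤ ((0 : ℕ) : WithBot ℕ∞) := by simpa using h1
      have := Nat.cast_le (α := WithBot ℕ∞).1 this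
      omega
    have hle : maximalIdeal R ^ 2 ⊔ I ≤ maximalIdeal R :=
      sup_le (Ideal.pow_le_self two_ne_zero) hIm
    have hne : maximalIdeal R ≠ maximalIdeal R ^ 2 ⊔ I := by
      intro h
      have h1 : maximalIdeal R ≤ I := by
        refine Submodule.le_of_le_smul_of_le_jacobson_bot (I := maximalIdeal R)
          (IsNoetherian.noetherian _)
          (by rw [IsLocalRing.jacobson_eq_maximalIdeal _ bot_ne_top]) ?_
        rw [smul_eq_mul, ← pow_two, sup_comm, ← h]
      have h2 : I = maximalIdeal R := le_antisymm hIm h1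
      apply hmin
      rw [h2, Ideal.minimalPrimes_eq_subsingleton_self]
      rfl
    obtain ⟨x, hxm, hx⟩ : ∃ x ∈ maximalIdeal R,
        x ∉ ⋃ J ∈ insert (maximalIdeal R ^ 2 ⊔ I) I.minimalPrimes, (J : Set R) := by
      by_contra! hcon
      have h1 := (Ideal.subset_iUnion_iff_mem_of_isMaximal_of_finite
        ((Ideal.finite_minimalPrimes_of_isNoetherianRing R I).insert (maximalIdeal R ^ 2 ⊔ I))
        (maximalIdeal R ^ 2 ⊔ I) (maximalIdeal R ^ 2 ⊔ I)
        (by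
          rintro J (rfl | hJ) h1 h2
          · exact absurd rfl h1
          · exact hJ.1.1)
        (ne_top_of_le_ne_top (Ideal.IsPrime.ne_top inferInstance) hle)
        (ne_top_of_le_ne_top (Ideal.IsPrime.ne_top inferInstance) hle)).1 hcon
      rcases h1 with h1 | h1
      · exact hne h1
      · exact hmin h1
    simp only [Set.mem_insert_iff, Set.iUnion_iUnion_eq_or_left, Set.mem_union, SetLike.mem_coe,
      Set.mem_iUnion, not_or, not_exists] at hx
    obtain ⟨hx2, hxp⟩ := hx
    -- exchange
    obtain ⟨t, ht, htc⟩ : ∃ t : Finset R, maximalIdeal R =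
        (I ⊔ Ideal.span {x}) ⊔ Ideal.span (t : Set R) ∧ t.card ≤ d := by
      have hx' := hxm
      rw [hs, Submodule.mem_sup] at hx'
      obtain ⟨y, hy, z, hz, rfl⟩ := hx'
      obtain ⟨c, hc'⟩ := (Submodule.mem_span_finset' (R := R)).1 hz
      have hsm : ∀ a ∈ s, a ∈ maximalIdeal R := fun a ha => by
        rw [hs]; exact Ideal.mem_sup_right (Ideal.subset_span ha)
      obtain ⟨a, ha⟩ : ∃ a : s, IsUnit (c a) := by
        by_contra! hcon
        apply hx2
        rw [sup_comm]
        refine Submodule.add_mem_sup hy ?_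
        rw [← hc']
        refine Ideal.sum_mem _ fun a _ => ?_
        rw [pow_two]
        exact Ideal.mul_mem_mul ((IsLocalRing.mem_maximalIdeal _).2 (hcon a)) (hsm _ a.2)
      refine ⟨s.erase a, ?_, by rw [Finset.card_erase_of_mem a.2]; omega⟩
      apply le_antisymm
      · rw [hs]
        refine sup_le (le_sup_left.trans le_sup_left) (Ideal.span_le.2 ?_)
        set T := (I ⊔ Ideal.span {y + z}) ⊔ Ideal.span ((s.erase a : Finset R) : Set R) with hT
        have hmemI : I ≤ T := le_sup_left.trans le_sup_left
        have hmemx : y + z ∈ T :=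
          Ideal.mem_sup_left (Ideal.mem_sup_right (Ideal.mem_span_singleton_self _))
        have hmems : ∀ b ∈ s, b ≠ a → b ∈ T := fun b hb hba =>
          Ideal.mem_sup_right (Ideal.subset_span (by simp [hb, hba]))
        have hzT : z ∈ T := by
          have := T.sub_mem hmemx (hmemI hy)
          simpa using this
        have haT : (a : R) ∈ T := by
          rw [← hc', ← Finset.add_sum_erase _ _ (Finset.mem_univ a)] at hzT
          have h2 : ∑ b ∈ Finset.univ.erase a, c b • (b : R) ∈ T :=
            Ideal.sum_mem _ fun b hb => T.mul_mem_left _ (hmems b b.2 fun h =>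
              (Finset.mem_erase.1 hb).1 (Subtype.ext h))
          have h3 := T.sub_mem hzT h2
          rw [add_sub_cancel_right, smul_eq_mul] at h3
          exact (Ideal.unit_mul_mem_iff_mem T ha).1 h3
        intro b hb
        by_cases hba : b = a
        · rw [hba]; exact haT
        · exact hmems b hb hba
      · refine sup_le (sup_le hIm ?_) (Ideal.span_le.2 fun b hb => hsm b ?_)
        · rwa [Ideal.span_singleton_le_iff_mem]
        · exact Finset.mem_of_mem_erase hb
    have hdim : (d : WithBot ℕ∞) ≤ ringKrullDim (R ⧸ (I ⊔ Ideal.span {x})) := by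
      have : Nontrivial (R ⧸ I) := Ideal.Quotient.nontrivial_iff.2
        (ne_top_of_le_ne_top (Ideal.IsPrime.ne_top inferInstance) hIm)
      have hloc : IsLocalRing (R ⧸ I) :=
        IsLocalRing.of_surjective' (Ideal.Quotient.mk I) Ideal.Quotient.mk_surjective
      have hlh : IsLocalHom (Ideal.Quotient.mk I) :=
        IsLocalHom.of_surjective _ Ideal.Quotient.mk_surjective
      have h1 := ringKrullDim_le_ringKrullDim_quotient_add_card
        ({Ideal.Quotient.mk I x} : Finset (R ⧸ I)) (by
          rw [← Ideal.jacobson_bot, IsLocalRing.jacobson_eq_maximalIdeal _ bot_ne_top]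
          simpa using map_nonunit (Ideal.Quotient.mk I) x hxm)
      have e := DoubleQuot.quotQuotEquivQuotSup I (Ideal.span {x})
      rw [Ideal.map_span, Set.image_singleton] at e
      rw [Finset.coe_singleton, Finset.card_singleton, ringKrullDim_eq_of_ringEquiv e] at h1
      have h2 := hd.trans h1
      rw [Nat.cast_add] at h2
      exact ENat.WithBot.add_le_add_natCast_right_iff.1 h2
    obtain ⟨hJ, hTor⟩ := ih (I ⊔ Ideal.span {x}) t ht htc hdim
    have hI : I.IsPrime := by
      obtain ⟨p, hp, hpJ⟩ := Ideal.exists_minimalPrimes_le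
        (le_sup_left : I ≤ I ⊔ Ideal.span {x})
      have hpp : p.IsPrime := hp.1.1
      have h1 : p ≤ I := by
        refine Submodule.le_of_le_smul_of_le_jacobson_bot (I := maximalIdeal R)
          (IsNoetherian.noetherian _)
          (by rw [IsLocalRing.jacobson_eq_maximalIdeal _ bot_ne_top]) ?_
        intro y hy
        obtain ⟨i, hi, z, hz, rfl⟩ := Submodule.mem_sup.1 (hpJ hy)
        obtain ⟨r, rfl⟩ := Ideal.mem_span_singleton.1 hz
        have h2 : x * r ∈ p := (Ideal.add_mem_iff_right p (hp.1.2 hi)).1 hy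
        have h3 : r ∈ p := (hpp.mem_or_mem h2).resolve_left (hxp p hp)
        exact Submodule.add_mem_sup hi (Submodule.smul_mem_smul hxm h3)
      rwa [← le_antisymm h1 hp.1.2]
    refine ⟨hI, fun N _ _ n hn => hTor N (n + 1) ?_⟩
    intro j hj
    obtain ⟨j, rfl⟩ : ∃ j', j = j' + 1 := ⟨j - 1, by omega⟩
    have hxI : x ∉ I := fun h => hx2 (Ideal.mem_sup_right h)
    exact torInj_right (primeSES I hI x hxI) j N (hn j (by omega)) (hn _ (by omega))

theorem regular_gens {R : Type u} [CommRing R] [IsLocalRing R] (I : Ideal R)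
    (h : IsRegularLocal (R ⧸ I)) :
    ∃ s : Finset R, maximalIdeal R = I ⊔ Ideal.span (s : Set R) ∧
      (s.card : WithBot ℕ∞) ≤ ringKrullDim (R ⧸ I) := by
  classical
  obtain ⟨_, _, s, hs, hc⟩ := h
  refine ⟨s.image Quotient.out, ?_, ?_⟩
  · have h1 : (Ideal.comap (Ideal.Quotient.mk I) (Ideal.span (s : Set (R ⧸ I)))).IsMaximal :=
      Ideal.comap_isMaximal_of_surjective _ Ideal.Quotient.mk_surjective
    rw [← IsLocalRing.eq_maximalIdeal h1]
    have h2 : Ideal.span (s : Set (R ⧸ I)) = Ideal.map (Ideal.Quotient.mk I)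
        (Ideal.span ((s.image Quotient.out : Finset R) : Set R)) := by
      rw [Ideal.map_span, Finset.coe_image, Set.image_image]
      congr 1
      have : ∀ y : R ⧸ I, Ideal.Quotient.mk I (Quotient.out y) = y := fun y => Quotient.out_eq y
      simp [this]
    rw [h2, Ideal.comap_map_of_surjective _ Ideal.Quotient.mk_surjective, sup_comm,
      ← RingHom.ker_eq_comap_bot, Ideal.mk_ker]
  · rw [← hc]
    exact_mod_cast Finset.card_image_le

end TorAux

/-- Lemma `ascent` of the paper. If `A → A'` is a weakly regular
homomorphism of noetherian local rings and `M` is a test module for `A`, then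
`A' ⊗_A M` is a test module for `A'`. -/
theorem isTestModule_baseChange_of_weaklyRegular
    (A : Type u) [CommRing A] [IsLocalRing A] [IsNoetherianRing A]
    (A' : Type u) [CommRing A'] [IsLocalRing A'] [IsNoetherianRing A'] [Algebra A A']
    (hwr : IsWeaklyRegularAlgebra A A')
    (M : Type u) [AddCommGroup M] [Module A M] [Module.Finite A M]
    (htest : IsTestModule A M) :
    IsTestModule A' (TensorProduct A A' M) := by
  obtain ⟨hloc, hflat, hreg⟩ := hwr
  intro B _ _ _ _ hB N _ _ _ _ hN hTor
  obtain ⟨i₀, hi₀⟩ := hTor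
  let _ : Algebra A B := ((algebraMap A' B).comp (algebraMap A A')).toAlgebra
  have : IsScalarTower A A' B := IsScalarTower.of_algebraMap_eq fun _ => rfl
  let _ : Module A N := Module.compHom N (algebraMap A A')
  have : IsScalarTower A A' N := IsScalarTower.of_algebraMap_smul fun _ _ => rfl
  have : IsScalarTower A B N := IsScalarTower.of_algebraMap_smul fun r x => by
    show (algebraMap A' B (algebraMap A A' r)) • x = algebraMap A A' r • x
    rw [algebraMap_smul]
  have hAB : IsLocalHom (algebraMap A B) :=
    RingHom.isLocalHom_comp (algebraMap A' B) (algebraMap A A')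
  obtain ⟨n, hn⟩ := htest B hAB N hN ⟨i₀ + 1, fun i hi => by
    obtain ⟨j, rfl⟩ : ∃ j, i = j + 1 := ⟨i - 1, by omega⟩
    rw [TorAux.torVanish_iff, ← TorAux.torInj_baseChange (A' := A'), ← TorAux.torVanish_iff]
    exact hi₀ _ (by omega)⟩
  have h1 : ∀ j ≥ n, TorAux.TorInj A' j
      (A' ⧸ Ideal.map (algebraMap A A') (maximalIdeal A)) N := fun j hj => by
    refine TorAux.torInj_equiv (Algebra.TensorProduct.quotIdealMapEquivTensorQuot A'
      (maximalIdeal A)).symm.toLinearEquiv j N ?_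
    rw [TorAux.torInj_baseChange]
    exact TorAux.flatDim_torInj n N hn _ j hj
  obtain ⟨s, hs, hc⟩ := TorAux.regular_gens _ hreg
  obtain ⟨n', hn'⟩ := (TorAux.regAux s.card _ s hs le_rfl hc).2 N n h1
  exact ⟨n', TorAux.flatDim_of_torInj n' N fun I =>
    TorAux.torInj_of_residue n' N (TorAux.PN.of_finite hB hN) (hn' n' le_rfl) I⟩
end

section
/- Let (A,m,k) → (A',m',k') be a weakly regular homomorphism of noetherian local rings, let A' → B be a local homomorphism of noetherian local rings, and let N be a finitely generated B-module. If N has finite flat dimension over A, then N has finite flat dimension over A'. -/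
open CategoryTheory IsLocalRing

universe u

open CategoryTheory.Abelian

/-- Vanishing of `Ext^i(M, N^∨)`, which is dual to `Tor_i(M, N)`. -/
def EV (R : Type u) [CommRing R] (i : ℕ) (M : Type u) [AddCommGroup M] [Module R M]
    (N : Type u) [AddCommGroup N] [Module R N] : Prop :=
  Subsingleton (Abelian.Ext.{u} (ModuleCat.of R M) (ModuleCat.of R (CharacterModule N)) i)

section basic

variable {R : Type u} [CommRing R] {M₁ M₂ M₃ : Type u} [AddCommGroup M₁] [Module R M₁]
  [AddCommGroup M₂] [Module R M₂] [AddCommGroup M₃] [Module R M₃]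
  {N : Type u} [AddCommGroup N] [Module R N]

theorem sc_exact (f : M₁ →ₗ[R] M₂) (g : M₂ →ₗ[R] M₃) (h : Function.Exact f g)
    (hf : Function.Injective f) (hg : Function.Surjective g) :
    (ModuleCat.shortComplexOfCompEqZero f g h.linearMap_comp_eq_zero).ShortExact :=
  ModuleCat.shortComplex_shortExact _ h hf hg

theorem EV.of_equiv {i : ℕ} (e : M₁ ≃ₗ[R] M₂) (h : EV R i M₁ N) : EV R i M₂ N := by
  refine @subsingleton_of_forall_eq _ 0 fun x => ?_
  have h1 : (Ext.mk₀ e.toModuleIso.hom).comp x (zero_add i) = 0 := h.elim _ _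
  have h2 : (Ext.mk₀ e.toModuleIso.inv).comp ((Ext.mk₀ e.toModuleIso.hom).comp x (zero_add i))
    (zero_add i) = x := by
    rw [Ext.mk₀_comp_mk₀_assoc, Iso.inv_hom_id, Ext.mk₀_id_comp]
  rw [← h2, h1, Ext.comp_zero]

theorem EV.mid {i : ℕ} (f : M₁ →ₗ[R] M₂) (g : M₂ →ₗ[R] M₃) (h : Function.Exact f g)
    (hf : Function.Injective f) (hg : Function.Surjective g)
    (h₁ : EV R i M₁ N) (h₃ : EV R i M₃ N) : EV R i M₂ N := by
  refine @subsingleton_of_forall_eq _ 0 fun x => ?_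
  obtain ⟨y, hy⟩ := Ext.contravariant_sequence_exact₂ (sc_exact f g h hf hg) _ x (h₁.elim _ _)
  rw [← hy, h₃.elim y 0, Ext.comp_zero]

theorem EV.right {i : ℕ} (f : M₁ →ₗ[R] M₂) (g : M₂ →ₗ[R] M₃) (h : Function.Exact f g)
    (hf : Function.Injective f) (hg : Function.Surjective g)
    (h₁ : EV R i M₁ N) (h₂ : EV R (i + 1) M₂ N) : EV R (i + 1) M₃ N := by
  refine @subsingleton_of_forall_eq _ 0 fun x => ?_
  obtain ⟨y, hy⟩ := Ext.contravariant_sequence_exact₃ (sc_exact f g h hf hg) _ x (h₂.elim _ _)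
    (add_comm 1 i)
  rw [← hy, h₁.elim y 0, Ext.comp_zero]

theorem EV.of_subsingleton [Subsingleton M₁] {i : ℕ} : EV R i M₁ N := by
  refine @subsingleton_of_forall_eq _ 0 fun x => ?_
  rw [← x.mk₀_id_comp, (ModuleCat.isZero_of_subsingleton (ModuleCat.of R M₁)).eq_zero_of_tgt (𝟙 _),
    Ext.mk₀_zero, Ext.zero_comp]

theorem EV.of_projective [Module.Projective R M₁] {i : ℕ} : EV R (i + 1) M₁ N := by
  have : Projective (ModuleCat.of R M₁) := by
    rw [← IsProjective.iff_projective]; infer_instance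
  exact Ext.subsingleton_of_projective _ _ _

theorem charInjective (h : Module.Flat R N) : Injective (ModuleCat.of R (CharacterModule N)) := by
  rw [← Module.injective_iff_injective_object, ← Module.Flat.iff_characterModule_injective]
  exact h

theorem EV.of_flat [h : Module.Flat R N] {i : ℕ} : EV R (i + 1) M₁ N := by
  have := charInjective h
  exact subsingleton_of_forall_eq 0 Ext.eq_zero_of_injective

/-- degree one -/
theorem EV.extend (f : M₁ →ₗ[R] M₂) (g : M₂ →ₗ[R] M₃) (h : Function.Exact f g)
    (hf : Function.Injective f) (hg : Function.Surjective g) (h₃ : EV R 1 M₃ N)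
    (φ : M₁ →ₗ[R] CharacterModule N) : ∃ ψ : M₂ →ₗ[R] CharacterModule N, ψ ∘ₗ f = φ := by
  obtain ⟨y, hy⟩ := Ext.contravariant_sequence_exact₁ (sc_exact f g h hf hg)
    (ModuleCat.of R (CharacterModule N)) (Ext.mk₀ (ModuleCat.ofHom φ)) (add_comm 1 0) (h₃.elim _ _)
  obtain ⟨z, rfl⟩ := Ext.homEquiv₀.symm.surjective y
  refine ⟨z.hom, ?_⟩
  simp only [Ext.homEquiv₀_symm_apply, Ext.mk₀_comp_mk₀] at hy
  have := (Ext.mk₀_bijective _ _).1 hy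
  exact congrArg ModuleCat.Hom.hom this

theorem EV.of_extend [Module.Projective R M₂]
    (f : M₁ →ₗ[R] M₂) (g : M₂ →ₗ[R] M₃) (h : Function.Exact f g)
    (hf : Function.Injective f) (hg : Function.Surjective g)
    (H : ∀ φ : M₁ →ₗ[R] CharacterModule N, ∃ ψ : M₂ →ₗ[R] CharacterModule N, ψ ∘ₗ f = φ) :
    EV R 1 M₃ N := by
  refine @subsingleton_of_forall_eq _ 0 fun x => ?_
  obtain ⟨y, hy⟩ := Ext.contravariant_sequence_exact₃ (sc_exact f g h hf hg) _ x
    ((EV.of_projective (R := R) (M₁ := M₂) (N := N) (i := 0)).elim _ _) (add_comm 1 0)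
  obtain ⟨z, rfl⟩ := Ext.homEquiv₀.symm.surjective y
  obtain ⟨ψ, hψ⟩ := H z.hom
  have : z = (ModuleCat.shortComplexOfCompEqZero f g h.linearMap_comp_eq_zero).f ≫
      ModuleCat.ofHom ψ := by
    ext1; exact hψ.symm
  rw [← hy, Ext.homEquiv₀_symm_apply, this, ← Ext.mk₀_comp_mk₀]
  rw [(sc_exact f g h hf hg).extClass_comp_assoc]

/-- kernel sequence for the second variable -/
theorem char_sc (f : M₁ →ₗ[R] M₂) (g : M₂ →ₗ[R] M₃) (h : Function.Exact f g)
    (hf : Function.Injective f) (hg : Function.Surjective g) :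
    Function.Exact (CharacterModule.dual g) (CharacterModule.dual f) ∧
    Function.Injective (CharacterModule.dual g) ∧ Function.Surjective (CharacterModule.dual f) := by
  refine ⟨?_, CharacterModule.dual_injective_of_surjective _ hg,
    CharacterModule.dual_surjective_of_injective _ hf⟩
  intro c
  constructor
  · intro hc
    have hS : ∀ m, g m = 0 → c m = 0 := by
      intro m hm
      obtain ⟨k, rfl⟩ := (h m).1 hm
      exact DFunLike.congr_fun hc k
    refine ⟨AddMonoidHom.liftOfSurjective (g.toAddMonoidHom) hg ⟨(c : M₂ →+ AddCircle (1 : ℚ)), ?_⟩, ?_⟩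
    · intro m hm; exact hS m hm
    · ext m
      exact AddMonoidHom.liftOfRightInverse_comp_apply _ _
        (Function.rightInverse_surjInv hg) _ m
  · rintro ⟨d, rfl⟩
    ext k
    change d (g (f k)) = 0
    rw [(h (f k)).2 ⟨k, rfl⟩, map_zero]

end basic
section second

variable {R : Type u} [CommRing R] {K F N : Type u} [AddCommGroup K] [Module R K]
  [AddCommGroup F] [Module R F] [AddCommGroup N] [Module R N]
  {M : Type u} [AddCommGroup M] [Module R M]

theorem EV.shift₂ [hF : Module.Flat R F] (f : K →ₗ[R] F) (g : F →ₗ[R] N) (h : Function.Exact f g)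
    (hf : Function.Injective f) (hg : Function.Surjective g) {i : ℕ}
    (H : EV R (i + 1) M K) : EV R (i + 2) M N := by
  obtain ⟨a, b, c⟩ := char_sc f g h hf hg
  refine @subsingleton_of_forall_eq _ 0 fun x => ?_
  obtain ⟨y, hy⟩ := Ext.covariant_sequence_exact₁ _ (sc_exact _ _ a b c) x
    ((EV.of_flat (N := F) (i := i + 1)).elim _ _) rfl
  rw [← hy, H.elim y 0, Ext.zero_comp]

theorem EV.unshift₂ [hF : Module.Flat R F] (f : K →ₗ[R] F) (g : F →ₗ[R] N) (h : Function.Exact f g)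
    (hf : Function.Injective f) (hg : Function.Surjective g) {i : ℕ}
    (H : EV R (i + 2) M N) : EV R (i + 1) M K := by
  obtain ⟨a, b, c⟩ := char_sc f g h hf hg
  refine @subsingleton_of_forall_eq _ 0 fun x => ?_
  obtain ⟨y, hy⟩ := Ext.covariant_sequence_exact₃ _ (sc_exact _ _ a b c) x rfl (H.elim _ _)
  rw [← hy, (EV.of_flat (N := F) (i := i)).elim y 0, Ext.zero_comp]

theorem EV.of_flatDimLE {n : ℕ} : ∀ {N : Type u} [AddCommGroup N] [Module R N],
    FlatDimLE R n N → EV R (n + 1) M N := by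
  induction n with
  | zero => intro N _ _ h; have : Module.Flat R N := h; exact EV.of_flat
  | succ n ih =>
    intro N _ _ h
    obtain ⟨F, _, _, hF, f, hf, hk⟩ := h
    exact EV.shift₂ (LinearMap.ker f).subtype f (LinearMap.exact_subtype_ker_map f)
      (Submodule.subtype_injective _) hf (ih hk)

theorem flat_of_EV (H : ∀ I : Ideal R, EV R 1 (R ⧸ I) N) : Module.Flat R N := by
  rw [Module.Flat.iff_characterModule_baer]
  intro I φ
  obtain ⟨ψ, hψ⟩ := EV.extend I.subtype I.mkQ (LinearMap.exact_subtype_mkQ I)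
    (Submodule.subtype_injective _) (Submodule.mkQ_surjective _) (H I) φ
  exact ⟨ψ, fun x hx => DFunLike.congr_fun hψ ⟨x, hx⟩⟩

/-- the canonical free cover -/
noncomputable def cov (R N : Type u) [CommRing R] [AddCommGroup N] [Module R N] :
    (N →₀ R) →ₗ[R] N := Finsupp.linearCombination R id

theorem cov_surj (R N : Type u) [CommRing R] [AddCommGroup N] [Module R N] :
    Function.Surjective (cov R N) := Finsupp.linearCombination_id_surjective R N

theorem flatDimLE_of_EV {n : ℕ} : ∀ {N : Type u} [AddCommGroup N] [Module R N],
    (∀ I : Ideal R, EV R (n + 1) (R ⧸ I) N) → FlatDimLE R n N := by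
  induction n with
  | zero => intro N _ _ h; exact flat_of_EV h
  | succ n ih =>
    intro N _ _ h
    refine ⟨N →₀ R, inferInstance, inferInstance, inferInstance, cov R N, cov_surj R N, ?_⟩
    exact ih fun I => EV.unshift₂ (LinearMap.ker (cov R N)).subtype (cov R N)
      (LinearMap.exact_subtype_ker_map _)
      (Submodule.subtype_injective _) (cov_surj R N) (h I)

end second

section basechange

variable {A : Type u} [CommRing A] {A' : Type u} [CommRing A'] [Algebra A A']

instance charTower {N : Type u} [AddCommGroup N] [Module A N] [Module A' N] [IsScalarTower A A' N] :
    IsScalarTower A A' (CharacterModule N) where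
  smul_assoc a a' c := by
    ext n
    simp only [CharacterModule.smul_apply]
    rw [smul_assoc, smul_comm]

open TensorProduct in
theorem bc_seq [Module.Flat A A'] {K F L : Type u} [AddCommGroup K] [Module A K]
    [AddCommGroup F] [Module A F] [AddCommGroup L] [Module A L] (k : K →ₗ[A] F) (g : F →ₗ[A] L)
    (hk : Function.Exact k g) (hki : Function.Injective k) (hg : Function.Surjective g) :
    Function.Exact (k.baseChange A') (g.baseChange A') ∧ Function.Injective (k.baseChange A') ∧
      Function.Surjective (g.baseChange A') :=
  ⟨lTensor_exact A' hk hg, Module.Flat.lTensor_preserves_injective_linearMap k hki,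
    LinearMap.lTensor_surjective A' hg⟩

open TensorProduct in
theorem EV.baseChange_one [Module.Flat A A'] {N : Type u} [AddCommGroup N] [Module A N]
    [Module A' N] [IsScalarTower A A' N] (hN : Module.Flat A N)
    {K F L : Type u} [AddCommGroup K] [Module A K]
    [AddCommGroup F] [Module A F] [Module.Projective A F]
    [AddCommGroup L] [Module A L] (k : K →ₗ[A] F) (g : F →ₗ[A] L)
    (hk : Function.Exact k g) (hki : Function.Injective k) (hg : Function.Surjective g) :
    EV A' 1 (A' ⊗[A] L) N := by
  obtain ⟨h1, h2, h3⟩ := bc_seq (A' := A') k g hk hki hg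
  refine EV.of_extend (k.baseChange A') (g.baseChange A') h1 h2 h3 ?_
  intro φ
  have hE := EV.of_flat (R := A) (M₁ := L) (N := N) (i := 0)
  obtain ⟨ψ, hψ⟩ := EV.extend k g hk hki hg hE
    ((φ.restrictScalars A) ∘ₗ (TensorProduct.mk A A' K 1))
  refine ⟨ψ.liftBaseChange A', ?_⟩
  ext x : 3
  have := DFunLike.congr_fun hψ x
  simpa using this

open TensorProduct in
theorem EV.baseChange_succ [Module.Flat A A'] {N : Type u} [AddCommGroup N]
    [Module A' N] {i : ℕ}
    {K F L : Type u} [AddCommGroup K] [Module A K]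
    [AddCommGroup F] [Module A F] [Module.Projective A F]
    [AddCommGroup L] [Module A L] (k : K →ₗ[A] F) (g : F →ₗ[A] L)
    (hk : Function.Exact k g) (hki : Function.Injective k) (hg : Function.Surjective g)
    (h : EV A' (i + 1) (A' ⊗[A] K) N) :
    EV A' (i + 2) (A' ⊗[A] L) N := by
  obtain ⟨h1, h2, h3⟩ := bc_seq (A' := A') k g hk hki hg
  exact EV.right (k.baseChange A') (g.baseChange A') h1 h2 h3 h EV.of_projective

theorem exists_cov (A L : Type u) [CommRing A] [AddCommGroup L] [Module A L] :
    ∃ (K : Type u) (_ : AddCommGroup K) (_ : Module A K) (F : Type u) (_ : AddCommGroup F)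
      (_ : Module A F) (_ : Module.Projective A F) (k : K →ₗ[A] F) (g : F →ₗ[A] L),
      Function.Exact k g ∧ Function.Injective k ∧ Function.Surjective g :=
  ⟨LinearMap.ker (cov A L), inferInstance, inferInstance, L →₀ A, inferInstance, inferInstance,
    inferInstance, (LinearMap.ker (cov A L)).subtype, cov A L,
    LinearMap.exact_subtype_ker_map _, Submodule.subtype_injective _, cov_surj A L⟩

open TensorProduct in
theorem EV.baseChange_flat [Module.Flat A A'] {N : Type u} [AddCommGroup N] [Module A N]
    [Module A' N] [IsScalarTower A A' N] (hN : Module.Flat A N) (i : ℕ) :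
    ∀ {L : Type u} [AddCommGroup L] [Module A L], EV A' (i + 1) (A' ⊗[A] L) N := by
  induction i with
  | zero =>
    intro L _ _
    obtain ⟨K, _, _, F, _, _, _, k, g, h1, h2, h3⟩ := exists_cov A L
    exact EV.baseChange_one hN k g h1 h2 h3
  | succ i ih =>
    intro L _ _
    obtain ⟨K, _, _, F, _, _, _, k, g, h1, h2, h3⟩ := exists_cov A L
    have key := ih (L := K)
    exact EV.baseChange_succ k g h1 h2 h3 key

open TensorProduct in
theorem EV.baseChange [hAA : Module.Flat A A'] (n : ℕ) : ∀ {N : Type u} [AddCommGroup N] [Module A N]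
    [Module A' N] [IsScalarTower A A' N],
    (∀ I : Ideal A, EV A (n + 1) (A ⧸ I) N) → ∀ (i : ℕ)
    {L : Type u} [AddCommGroup L] [Module A L], EV A' (n + i + 1) (A' ⊗[A] L) N := by
  induction n with
  | zero =>
    intro N _ _ _ _ h i L _ _
    rw [zero_add]
    exact EV.baseChange_flat (flat_of_EV h) i
  | succ n ih =>
    intro N _ _ _ _ h i L _ _
    let k := (LinearMap.ker (cov A' N)).subtype
    have hk : Function.Exact k (cov A' N) := LinearMap.exact_subtype_ker_map _
    have hki : Function.Injective k := Submodule.subtype_injective _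
    have hfl : Module.Flat A (N →₀ A') := Module.Flat.trans A A' (N →₀ A')
    have key := ih (N := LinearMap.ker (cov A' N)) (fun I =>
      EV.unshift₂ (R := A) (k.restrictScalars A) ((cov A' N).restrictScalars A) hk hki
        (cov_surj A' N) (h I)) i (L := L)
    have := EV.shift₂ k (cov A' N) hk hki (cov_surj A' N) key
    rwa [show n + 1 + i + 1 = n + i + 2 by omega]

end basechange
section nakayama

open TensorProduct

theorem char_mem_range {R : Type u} [CommRing R] {P Q : Type u} [AddCommGroup P] [Module R P]
    [AddCommGroup Q] [Module R Q] (T : P →ₗ[R] Q) (c : CharacterModule P)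
    (hc : ∀ p, T p = 0 → c p = 0) : ∃ d, CharacterModule.dual T d = c := by
  have hs : Function.Surjective T.rangeRestrict := T.surjective_rangeRestrict
  obtain ⟨a, -, -⟩ := char_sc (LinearMap.ker T).subtype T.rangeRestrict
    (by
      intro p
      rw [Submodule.coe_subtype, Subtype.range_coe]
      exact ⟨fun h => congrArg Subtype.val h, fun h => Subtype.ext h⟩)
    (Submodule.subtype_injective _) hs
  obtain ⟨d₁, hd₁⟩ := (a c).1 (by ext p; exact hc p.1 p.2)
  obtain ⟨d, hd⟩ := CharacterModule.dual_surjective_of_injective (LinearMap.range T).subtype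
    (Submodule.subtype_injective _) d₁
  refine ⟨d, ?_⟩
  rw [← hd₁, ← hd]
  rfl

/-- Hom-tensor duality -/
noncomputable def VV (R K N : Type u) [CommRing R] [AddCommGroup K] [Module R K]
    [AddCommGroup N] [Module R N] :
    (K →ₗ[R] CharacterModule N) ≃ₗ[R] CharacterModule (N ⊗[R] K) :=
  CharacterModule.homEquiv.trans (CharacterModule.congr (TensorProduct.comm R K N))

theorem VV_comp {R K F N : Type u} [CommRing R] [AddCommGroup K] [Module R K]
    [AddCommGroup N] [Module R N] [AddCommGroup F] [Module R F] (f : K →ₗ[R] F)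
    (ψ : F →ₗ[R] CharacterModule N) :
    VV R K N (ψ ∘ₗ f) = CharacterModule.dual (f.lTensor N) (VV R F N ψ) := by
  ext t
  induction t with
  | zero => rw [map_zero, map_zero]
  | add a b ha hb => rw [map_add, map_add, ha, hb]
  | tmul n k => rfl

variable {R : Type u} [CommRing R] {B : Type u} [CommRing B] [IsLocalRing B] [IsNoetherianRing B]
  [Algebra R B] {N : Type u} [AddCommGroup N] [Module R N] [Module B N] [IsScalarTower R B N]
  [Module.Finite B N]

theorem nak_inj {K F : Type u} [AddCommGroup K] [Module R K] [Module.Finite R K]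
    [AddCommGroup F] [Module R F] (f : K →ₗ[R] F) (x : R)
    (hx : algebraMap R B x ∈ maximalIdeal B)
    (H : ∀ c : CharacterModule (N ⊗[R] K),
      (∃ d, CharacterModule.dual (f.lTensor N) d = x • c) →
        ∃ d, CharacterModule.dual (f.lTensor N) d = c) :
    Function.Injective (f.lTensor N) := by
  let T : N ⊗[R] K →ₗ[B] N ⊗[R] F := AlgebraTensorModule.lTensor B N f
  have hT : ∀ t, T t = f.lTensor N t := fun t => rfl
  have hfin : Module.Finite B (N ⊗[R] K) :=
    Module.Finite.equiv (AlgebraTensorModule.cancelBaseChange R B B N K)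
  have hbot : LinearMap.ker T = ⊥ := by
    refine Submodule.eq_bot_of_le_smul_of_le_jacobson_bot (maximalIdeal B) _
      (IsNoetherian.noetherian _) ?_ (IsLocalRing.maximalIdeal_le_jacobson ⊥)
    intro q hq
    by_contra hqW
    set W := maximalIdeal B • LinearMap.ker T with hW
    have hne : W.mkQ q ≠ 0 := by
      simpa [Submodule.Quotient.mk_eq_zero] using hqW
    obtain ⟨c, hc⟩ := CharacterModule.exists_character_apply_ne_zero_of_ne_zero hne
    let c' : CharacterModule (N ⊗[R] K) := CharacterModule.dual W.mkQ c
    obtain ⟨d, hd⟩ := H c' (char_mem_range _ _ (by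
      intro p hp
      rw [CharacterModule.smul_apply]
      change c (W.mkQ (x • p)) = 0
      have : x • p ∈ W := by
        rw [← algebraMap_smul B x p]
        exact Submodule.smul_mem_smul hx hp
      rw [(Submodule.Quotient.mk_eq_zero W).2 this |> fun h => (h : W.mkQ (x • p) = 0), map_zero]))
    apply hc
    have h1 : c' q = d (f.lTensor N q) := by rw [← hd]; rfl
    change c' q = 0
    rw [h1, ← hT, LinearMap.mem_ker.1 hq, map_zero]
  intro a b hab
  exact LinearMap.ker_eq_bot.1 hbot hab

theorem EV.nak_one {K F M : Type u} [AddCommGroup K] [Module R K]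
    [Module.Finite R K]
    [AddCommGroup F] [Module R F] [Module.Projective R F] [AddCommGroup M] [Module R M]
    (f : K →ₗ[R] F) (g : F →ₗ[R] M) (h : Function.Exact f g)
    (hf : Function.Injective f) (hg : Function.Surjective g) (x : R)
    (hx : algebraMap R B x ∈ maximalIdeal B)
    (H : ∀ e : Abelian.Ext.{u} (ModuleCat.of R M) (ModuleCat.of R (CharacterModule N)) 1,
      x • e = 0 → e = 0) : EV R 1 M N := by
  have hS := sc_exact f g h hf hg
  have key : Function.Injective (f.lTensor N) := by
    refine nak_inj (B := B) f x hx ?_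
    rintro c ⟨d, hd⟩
    obtain ⟨φ, rfl⟩ := (VV R K N).surjective c
    obtain ⟨ψ, rfl⟩ := (VV R F N).surjective d
    rw [← VV_comp, ← map_smul] at hd
    have hd := (VV R K N).injective hd
    have h0 : hS.extClass.comp (Ext.mk₀ (ModuleCat.ofHom φ)) (add_comm 1 0) = 0 := by
      apply H
      rw [← Ext.comp_smul, ← Ext.mk₀_smul]
      have : x • ModuleCat.ofHom φ = (ModuleCat.shortComplexOfCompEqZero f g
          h.linearMap_comp_eq_zero).f ≫ ModuleCat.ofHom ψ := by
        ext1; exact hd.symm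
      rw [this, ← Ext.mk₀_comp_mk₀, hS.extClass_comp_assoc]
    obtain ⟨y, hy⟩ := Ext.contravariant_sequence_exact₁ hS
      (ModuleCat.of R (CharacterModule N)) (Ext.mk₀ (ModuleCat.ofHom φ)) (add_comm 1 0) h0
    obtain ⟨z, rfl⟩ := Ext.homEquiv₀.symm.surjective y
    simp only [Ext.homEquiv₀_symm_apply, Ext.mk₀_comp_mk₀] at hy
    have hz := congrArg ModuleCat.Hom.hom ((Ext.mk₀_bijective _ _).1 hy)
    refine ⟨VV R F N z.hom, ?_⟩
    rw [← VV_comp]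
    exact congrArg _ hz
  refine EV.of_extend f g h hf hg fun φ => ?_
  obtain ⟨d, hd⟩ := CharacterModule.dual_surjective_of_injective _ key (VV R K N φ)
  obtain ⟨ψ, rfl⟩ := (VV R F N).surjective d
  exact ⟨ψ, (VV R K N).injective (by rw [VV_comp, hd])⟩

theorem EV.nak_step {K F M : Type u} [AddCommGroup K] [Module R K]
    [AddCommGroup F] [Module R F] [Module.Projective R F] [AddCommGroup M] [Module R M]
    {N : Type u} [AddCommGroup N] [Module R N]
    (f : K →ₗ[R] F) (g : F →ₗ[R] M) (h : Function.Exact f g)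
    (hf : Function.Injective f) (hg : Function.Surjective g) (x : R) (i : ℕ)
    (H : ∀ e : Abelian.Ext.{u} (ModuleCat.of R M) (ModuleCat.of R (CharacterModule N)) (i + 2),
      x • e = 0 → e = 0)
    (e : Abelian.Ext.{u} (ModuleCat.of R K) (ModuleCat.of R (CharacterModule N)) (i + 1))
    (he : x • e = 0) : e = 0 := by
  have hS := sc_exact f g h hf hg
  have h0 : hS.extClass.comp e (add_comm 1 (i + 1)) = 0 := by
    apply H
    erw [← Ext.comp_smul, he, Ext.comp_zero]
  obtain ⟨y, hy⟩ := Ext.contravariant_sequence_exact₁ hS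
      (ModuleCat.of R (CharacterModule N)) e (add_comm 1 _) h0
  rw [← hy, (EV.of_projective (R := R) (M₁ := F) (N := N) (i := i)).elim y 0, Ext.comp_zero]

theorem EV.nak [IsNoetherianRing R] (x : R)
    (hx : algebraMap R B x ∈ maximalIdeal B) (i : ℕ) :
    ∀ {M : Type u} [AddCommGroup M] [Module R M] [Module.Finite R M]
    (_ : ∀ e : Abelian.Ext.{u} (ModuleCat.of R M) (ModuleCat.of R (CharacterModule N)) (i + 1),
      x • e = 0 → e = 0), EV R (i + 1) M N := by
  induction i with
  | zero =>
    intro M _ _ _ H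
    obtain ⟨n, g, hg⟩ := Module.Finite.exists_fin' R M
    exact EV.nak_one (B := B) (K := LinearMap.ker g) (F := Fin n → R) (LinearMap.ker g).subtype g
      (LinearMap.exact_subtype_ker_map _) (Submodule.subtype_injective _) hg x hx H
  | succ i ih =>
    intro M _ _ _ H
    obtain ⟨n, g, hg⟩ := Module.Finite.exists_fin' R M
    refine EV.right (M₁ := LinearMap.ker g) (M₂ := Fin n → R) (LinearMap.ker g).subtype g
      (LinearMap.exact_subtype_ker_map _) (Submodule.subtype_injective _) hg (ih ?_)
      EV.of_projective
    exact EV.nak_step (K := LinearMap.ker g) (F := Fin n → R) (LinearMap.ker g).subtype g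
      (LinearMap.exact_subtype_ker_map _) (Submodule.subtype_injective _) hg x i H

theorem EV.of_quot [IsNoetherianRing R] (x : R)
    (hx : algebraMap R B x ∈ maximalIdeal B) (i : ℕ)
    {M Q : Type u} [AddCommGroup M] [Module R M] [Module.Finite R M]
    [AddCommGroup Q] [Module R Q] (g : M →ₗ[R] Q) (h : Function.Exact (LinearMap.lsmul R M x) g)
    (hf : Function.Injective (LinearMap.lsmul R M x)) (hg : Function.Surjective g)
    (H : EV R (i + 1) Q N) : EV R (i + 1) M N := by
  refine EV.nak (B := B) x hx i fun e he => ?_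
  obtain ⟨y, hy⟩ := Ext.contravariant_sequence_exact₂ (sc_exact _ g h hf hg) _ e (by
    have : (ModuleCat.shortComplexOfCompEqZero _ g h.linearMap_comp_eq_zero).f =
      x • 𝟙 (ModuleCat.of R M) := by ext; rfl
    rw [this, Ext.mk₀_smul, Ext.smul_comp, Ext.mk₀_id_comp]
    exact he)
  rw [← hy, H.elim y 0, Ext.comp_zero]

end nakayama
section regular

variable {R : Type u} [CommRing R] [IsLocalRing R] [IsNoetherianRing R]

theorem dim_le_zero_of_minimal {J : Ideal R} (h : maximalIdeal R ∈ J.minimalPrimes) :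
    ringKrullDim (R ⧸ J) ≤ 0 := by
  have : Ring.KrullDimLE 0 (R ⧸ J) := by
    rw [Ring.krullDimLE_zero_iff]
    intro I hI
    have h1 : J ≤ I.comap (Ideal.Quotient.mk J) := by
      intro y hy
      rw [Ideal.mem_comap, Ideal.Quotient.eq_zero_iff_mem.2 hy]
      exact I.zero_mem
    have hp : (I.comap (Ideal.Quotient.mk J)).IsPrime := Ideal.comap_isPrime _ _
    have h2 : I.comap (Ideal.Quotient.mk J) = maximalIdeal R :=
      le_antisymm (IsLocalRing.le_maximalIdeal hp.ne_top)
        (h.2 ⟨hp, h1⟩ (IsLocalRing.le_maximalIdeal hp.ne_top))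
    have hm : (I.comap (Ideal.Quotient.mk J)).IsMaximal := h2 ▸ inferInstance
    have := Ideal.map_eq_top_or_isMaximal_of_surjective (Ideal.Quotient.mk J)
      Ideal.Quotient.mk_surjective hm
    rw [Ideal.map_comap_of_surjective _ Ideal.Quotient.mk_surjective] at this
    exact this.resolve_left hI.ne_top
  simpa using Ring.krullDimLE_iff.1 this

theorem dim_quot_le {J : Ideal R} (hJ : J ≤ maximalIdeal R) {x : R} (hx : x ∈ maximalIdeal R) :
    ringKrullDim (R ⧸ J) ≤ ringKrullDim (R ⧸ (J ⊔ Ideal.span {x})) + 1 := by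
  have hne : J ≠ ⊤ := fun h => (Ideal.IsPrime.ne_top inferInstance : maximalIdeal R ≠ ⊤)
    (top_le_iff.1 (h ▸ hJ))
  have : Nontrivial (R ⧸ J) := Ideal.Quotient.nontrivial_iff.2 hne
  have : IsLocalRing (R ⧸ J) := IsLocalRing.of_surjective' _ Ideal.Quotient.mk_surjective
  have h1 := ringKrullDim_le_ringKrullDim_quotient_add_card (R := R ⧸ J)
    {Ideal.Quotient.mk J x} (by
      rw [Finset.coe_singleton, Set.singleton_subset_iff, IsLocalRing.ringJacobson_eq_maximalIdeal]
      have h0 := IsLocalRing.eq_maximalIdeal (Ideal.comap_isMaximal_of_surjective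
        (Ideal.Quotient.mk J) Ideal.Quotient.mk_surjective (K := maximalIdeal (R ⧸ J)))
      rw [← h0] at hx
      exact hx)
  rw [Finset.coe_singleton, Finset.card_singleton, ← Set.image_singleton, ← Ideal.map_span,
    ringKrullDim_eq_of_ringEquiv (DoubleQuot.quotQuotEquivQuotSup J (Ideal.span {x}))] at h1
  simpa using h1

/-- regular parameters modulo `J` -/
def RP (R : Type u) [CommRing R] [IsLocalRing R] (J : Ideal R) (n : ℕ) : Prop :=
  ∃ s : Finset R, s.card = n ∧ maximalIdeal R = J ⊔ Ideal.span (s : Set R) ∧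
    (n : WithBot ℕ∞) ≤ ringKrullDim (R ⧸ J)

theorem RP.step {J : Ideal R} {n : ℕ} (h : RP R J (n + 1)) :
    ∃ x ∈ maximalIdeal R, (∀ p ∈ J.minimalPrimes, x ∉ p) ∧ RP R (J ⊔ Ideal.span {x}) n := by
  classical
  obtain ⟨s, hs, hm, hd⟩ := h
  have hJ : J ≤ maximalIdeal R := hm ▸ le_sup_left
  have hmin : maximalIdeal R ∉ J.minimalPrimes := by
    intro h
    have := hd.trans (dim_le_zero_of_minimal h)
    norm_cast at this
  have hjac : maximalIdeal R ≤ Ideal.jacobson ⊥ := IsLocalRing.maximalIdeal_le_jacobson ⊥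
  have hm2 : ¬ maximalIdeal R ≤ J ⊔ maximalIdeal R * maximalIdeal R := by
    intro h
    have h1 : maximalIdeal R ≤ J := Submodule.le_of_le_smul_of_le_jacobson_bot
      (IsNoetherian.noetherian _) hjac h
    have h2 : J = maximalIdeal R := le_antisymm hJ h1
    apply hmin
    rw [h2, Ideal.minimalPrimes_eq_subsingleton_self]
    rfl
  set I₂ := J ⊔ maximalIdeal R * maximalIdeal R
  have hfin := J.finite_minimalPrimes_of_isNoetherianRing
  have hav : ¬ ((maximalIdeal R : Set R) ⊆ ⋃ i ∈ (↑(insert I₂ hfin.toFinset) : Set (Ideal R)),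
      ((id i : Ideal R) : Set R)) := by
    rw [Ideal.subset_union_prime I₂ I₂]
    · rintro ⟨i, hi, hle⟩
      rw [Finset.mem_insert] at hi
      rcases hi with rfl | hi
      · exact hm2 hle
      · have hi := hfin.mem_toFinset.1 hi
        have : i = maximalIdeal R := le_antisymm (IsLocalRing.le_maximalIdeal hi.1.1.ne_top) hle
        exact hmin (this ▸ hi)
    · intro i hi hne _
      rw [Finset.mem_insert] at hi
      exact (hfin.mem_toFinset.1 (hi.resolve_left hne)).1.1
  obtain ⟨x, hxm, hx⟩ := Set.not_subset.1 hav
  simp only [Set.mem_iUnion, not_exists] at hx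
  have hxI : x ∉ I₂ := hx I₂ (by simp)
  refine ⟨x, hxm, fun p hp => hx p (by simp [hp]), ?_⟩
  have hsm : ∀ y ∈ s, y ∈ maximalIdeal R := fun y hy => by
    rw [hm]; exact Ideal.mem_sup_right (Ideal.subset_span hy)
  have hx' : x ∈ J ⊔ Ideal.span (s : Set R) := hm ▸ hxm
  obtain ⟨j, hj, t, ht, hjt⟩ := Submodule.mem_sup.1 hx'
  obtain ⟨a, -, ha⟩ := Submodule.mem_span_finset.1 ht
  obtain ⟨y, hy, hay⟩ : ∃ y ∈ s, a y ∉ maximalIdeal R := by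
    by_contra! hcon
    apply hxI
    rw [← hjt, ← ha]
    refine Submodule.add_mem_sup hj (Submodule.sum_mem _ fun i hi => ?_)
    exact Ideal.mul_mem_mul (hcon i hi) (hsm i hi)
  have hu : IsUnit (a y) := by
    by_contra hc
    exact hay hc
  refine ⟨s.erase y, by rw [Finset.card_erase_of_mem hy, hs]; rfl, le_antisymm ?_ ?_, ?_⟩
  · rw [hm]
    refine sup_le (le_sup_left.trans le_sup_left) (Ideal.span_le.2 fun z hz => ?_)
    by_cases hzy : z = y
    · subst hzy
      rw [SetLike.mem_coe]
      have : a z * z = x - j - ∑ i ∈ s.erase z, a i • i := by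
        rw [← hjt, ← ha, ← Finset.add_sum_erase s _ hy, smul_eq_mul]
        ring
      have h2 : a z * z ∈ J ⊔ Ideal.span {x} ⊔ Ideal.span (s.erase z : Set R) := by
        rw [this]
        refine sub_mem (sub_mem ?_ ?_) (Submodule.sum_mem _ fun i hi => ?_)
        · exact Ideal.mem_sup_left (Ideal.mem_sup_right (Ideal.mem_span_singleton_self x))
        · exact Ideal.mem_sup_left (Ideal.mem_sup_left hj)
        · exact Ideal.mul_mem_left _ _ (Ideal.mem_sup_right (Ideal.subset_span hi))
      exact (Ideal.unit_mul_mem_iff_mem _ hu).1 h2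
    · exact Ideal.mem_sup_right (Ideal.subset_span (by
        rw [Finset.mem_coe, Finset.mem_erase]; exact ⟨hzy, hz⟩))
  · refine sup_le (sup_le hJ ?_) (Ideal.span_le.2 fun z hz => hsm z (Finset.mem_of_mem_erase hz))
    rw [Ideal.span_singleton_le_iff_mem]
    exact hxm
  · have h3 := hd.trans (dim_quot_le hJ hxm)
    push_cast at h3
    exact ENat.WithBot.add_le_add_one_right_iff.1 h3

theorem RP.isPrime {n : ℕ} : ∀ {J : Ideal R}, RP R J n → J.IsPrime := by
  induction n with
  | zero =>
    rintro J ⟨s, hs, hm, -⟩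
    rw [Finset.card_eq_zero] at hs
    subst hs
    have : J = maximalIdeal R := by simpa using hm.symm
    rw [this]; infer_instance
  | succ n ih =>
    intro J h
    obtain ⟨x, hxm, hx, h'⟩ := h.step
    have hp' := ih h'
    obtain ⟨p, hp, hle⟩ := Ideal.exists_minimalPrimes_le (I := J)
      (J := J ⊔ Ideal.span {x}) le_sup_left
    have hpp : p.IsPrime := hp.1.1
    have hpJ : p ≤ J := by
      refine Submodule.le_of_le_smul_of_le_jacobson_bot (I := maximalIdeal R)
        (IsNoetherian.noetherian _) (IsLocalRing.maximalIdeal_le_jacobson ⊥) fun y hy => ?_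
      obtain ⟨j, hj, t, ht, rfl⟩ := Submodule.mem_sup.1 (hle hy)
      obtain ⟨r, rfl⟩ := Ideal.mem_span_singleton'.1 ht
      have h1 : r * x ∈ p := by
        have := p.sub_mem hy (hp.1.2 hj)
        rwa [add_sub_cancel_left] at this
      have h2 : r ∈ p := (hpp.mem_or_mem h1).resolve_right (hx p hp)
      refine Submodule.add_mem_sup hj ?_
      rw [mul_comm]
      exact Submodule.smul_mem_smul hxm h2
    rw [le_antisymm hp.1.2 hpJ]
    exact hpp

end regular
section devissage

variable {R : Type u} [CommRing R]

/-- colon ideal `(I : a)` -/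
def colonI (I : Ideal R) (a : R) : Ideal R := Submodule.comap (LinearMap.lsmul R R a) I

theorem mem_colonI {I : Ideal R} {a r : R} : r ∈ colonI I a ↔ a * r ∈ I := Iff.rfl

/-- multiplication by `a` -/
def colonMap (I : Ideal R) (a : R) : (R ⧸ colonI I a) →ₗ[R] (R ⧸ I) :=
  Submodule.mapQ (colonI I a) I (LinearMap.lsmul R R a) le_rfl

theorem colonMap_mk (I : Ideal R) (a r : R) :
    colonMap I a (Submodule.Quotient.mk r) = Submodule.Quotient.mk (a * r) := rfl

/-- projection -/
def colonProj (I : Ideal R) (a : R) : (R ⧸ I) →ₗ[R] (R ⧸ (I ⊔ Ideal.span {a})) :=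
  Submodule.factor le_sup_left

theorem colonProj_mk (I : Ideal R) (a r : R) :
    colonProj I a (Submodule.Quotient.mk r) = Submodule.Quotient.mk r := rfl

theorem colonMap_inj (I : Ideal R) (a : R) : Function.Injective (colonMap I a) := by
  rw [injective_iff_map_eq_zero]
  intro q hq
  obtain ⟨r, rfl⟩ := Submodule.Quotient.mk_surjective _ q
  rw [colonMap_mk, Submodule.Quotient.mk_eq_zero] at hq
  exact (Submodule.Quotient.mk_eq_zero _).2 hq

theorem colonProj_surj (I : Ideal R) (a : R) : Function.Surjective (colonProj I a) := by
  intro q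
  obtain ⟨r, rfl⟩ := Submodule.Quotient.mk_surjective _ q
  exact ⟨Submodule.Quotient.mk r, rfl⟩

theorem colonProj_eq_zero (I : Ideal R) (a : R) (q : R ⧸ I) :
    colonProj I a q = 0 ↔ ∃ r, Submodule.Quotient.mk (a * r) = q := by
  obtain ⟨y, rfl⟩ := Submodule.Quotient.mk_surjective _ q
  rw [colonProj_mk, Submodule.Quotient.mk_eq_zero]
  constructor
  · intro h
    obtain ⟨j, hj, t, ht, rfl⟩ := Submodule.mem_sup.1 h
    obtain ⟨r, rfl⟩ := Ideal.mem_span_singleton'.1 ht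
    refine ⟨r, (Submodule.Quotient.eq _).2 ?_⟩
    have : a * r - (j + r * a) = -j := by ring
    rw [this]
    exact I.neg_mem hj
  · rintro ⟨r, hr⟩
    have h1 := (Submodule.Quotient.eq _).1 hr
    have : y = -(a * r - y) + r * a := by ring
    rw [this]
    exact Submodule.add_mem_sup (I.neg_mem h1) (Ideal.mem_span_singleton'.2 ⟨r, rfl⟩)

theorem colon_exact (I : Ideal R) (a : R) : Function.Exact (colonMap I a) (colonProj I a) := by
  intro q
  rw [colonProj_eq_zero]
  constructor
  · rintro ⟨r, hr⟩
    exact ⟨Submodule.Quotient.mk r, hr⟩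
  · rintro ⟨z, rfl⟩
    obtain ⟨r, rfl⟩ := Submodule.Quotient.mk_surjective _ z
    exact ⟨r, rfl⟩

theorem lsmul_inj {I : Ideal R} (hI : I.IsPrime) {a : R} (ha : a ∉ I) :
    Function.Injective (LinearMap.lsmul R (R ⧸ I) a) := by
  rw [injective_iff_map_eq_zero]
  intro q hq
  obtain ⟨r, rfl⟩ := Submodule.Quotient.mk_surjective _ q
  rw [LinearMap.lsmul_apply, ← Submodule.Quotient.mk_smul, Submodule.Quotient.mk_eq_zero] at hq
  exact (Submodule.Quotient.mk_eq_zero _).2 ((hI.mem_or_mem hq).resolve_left ha)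

theorem lsmul_exact (I : Ideal R) (a : R) :
    Function.Exact (LinearMap.lsmul R (R ⧸ I) a) (colonProj I a) := by
  intro q
  rw [colonProj_eq_zero]
  constructor
  · rintro ⟨r, hr⟩
    exact ⟨Submodule.Quotient.mk r, hr⟩
  · rintro ⟨z, rfl⟩
    obtain ⟨r, rfl⟩ := Submodule.Quotient.mk_surjective _ z
    exact ⟨r, rfl⟩

theorem lt_sup_span {I : Ideal R} {a : R} (ha : a ∉ I) : I < I ⊔ Ideal.span {a} :=
  lt_of_le_of_ne le_sup_left fun h => ha (h ▸ Ideal.mem_sup_right (Ideal.mem_span_singleton_self a))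

variable [IsLocalRing R] [IsNoetherianRing R]

theorem EV.koszul {N : Type u} [AddCommGroup N] [Module R N] (d : ℕ) :
    ∀ {J : Ideal R} {n : ℕ}, RP R J d → (∀ i, EV R (n + i + 1) (R ⧸ J) N) →
      ∀ i, EV R (n + d + i + 1) (R ⧸ maximalIdeal R) N := by
  induction d with
  | zero =>
    rintro J n ⟨s, hs, hm, -⟩ h i
    rw [Finset.card_eq_zero] at hs
    subst hs
    have : maximalIdeal R = J := by simpa using hm
    rw [this]
    exact h i
  | succ d ih =>
    intro J n hJ h i
    obtain ⟨x, hxm, hx, h'⟩ := hJ.step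
    have hp := hJ.isPrime
    have hxJ : x ∉ J := hx J (by rw [Ideal.minimalPrimes_eq_subsingleton_self]; rfl)
    have := ih (n := n + 1) h' (fun i => by
      refine EV.right (LinearMap.lsmul R (R ⧸ J) x) (colonProj J x) (lsmul_exact J x)
        (lsmul_inj hp hxJ) (colonProj_surj J x) ?_ ?_
      · have := h i
        rwa [show n + 1 + i = n + i + 1 by omega]
      · have := h (i + 1)
        rwa [show n + 1 + i + 1 = n + (i + 1) + 1 by omega]) i
    rwa [show n + (d + 1) + i + 1 = n + 1 + d + i + 1 by omega]

theorem EV.devissage {B : Type u} [CommRing B] [IsLocalRing B] [IsNoetherianRing B]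
    [Algebra R B] (hloc : IsLocalHom (algebraMap R B))
    {N : Type u} [AddCommGroup N] [Module R N] [Module B N] [IsScalarTower R B N]
    [Module.Finite B N] {i : ℕ} (h : EV R (i + 1) (R ⧸ maximalIdeal R) N) (I : Ideal R) :
    EV R (i + 1) (R ⧸ I) N := by
  induction I using WellFoundedGT.induction with
  | ind I ih =>
    by_cases htop : I = ⊤
    · have : Subsingleton (R ⧸ I) := Ideal.Quotient.subsingleton_iff.2 htop
      exact EV.of_subsingleton
    by_cases hI : I.IsPrime
    · by_cases hm : maximalIdeal R ≤ I
      · rw [le_antisymm (IsLocalRing.le_maximalIdeal htop) hm]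
        exact h
      · obtain ⟨x, hxm, hxI⟩ := Set.not_subset.1 hm
        have hxB : algebraMap R B x ∈ maximalIdeal B := map_nonunit (algebraMap R B) x hxm
        exact EV.of_quot (B := B) x hxB i (colonProj I x) (lsmul_exact I x) (lsmul_inj hI hxI)
          (colonProj_surj I x) (ih _ (lt_sup_span hxI))
    · rw [Ideal.not_isPrime_iff] at hI
      obtain ⟨a, ha, b, hb, hab⟩ := hI.resolve_left htop
      refine EV.mid (colonMap I a) (colonProj I a) (colon_exact I a) (colonMap_inj I a)
        (colonProj_surj I a) (ih _ ?_) (ih _ (lt_sup_span ha))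
      refine lt_of_le_of_ne (fun r hr => mem_colonI.2 (I.mul_mem_left a hr)) fun hh => hb ?_
      rw [hh]
      exact mem_colonI.2 hab

theorem RP.of_regular {J : Ideal R} (h : IsRegularLocal (R ⧸ J)) : ∃ n, RP R J n := by
  classical
  obtain ⟨-, hl, s, hs, hc⟩ := h
  let f : R ⧸ J → R := Function.surjInv Ideal.Quotient.mk_surjective
  have hf : ∀ q, Ideal.Quotient.mk J (f q) = q := Function.surjInv_eq _
  refine ⟨(s.image f).card, s.image f, rfl, ?_, ?_⟩
  · have h1 := IsLocalRing.eq_maximalIdeal (Ideal.comap_isMaximal_of_surjective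
        (Ideal.Quotient.mk J) Ideal.Quotient.mk_surjective (K := Ideal.span (s : Set (R ⧸ J))))
    have h2 : (s : Set (R ⧸ J)) = Set.image (Ideal.Quotient.mk J) ((s.image f : Finset R) : Set R) := by
      rw [Finset.coe_image, ← Set.image_comp]
      have : (Ideal.Quotient.mk J : R → R ⧸ J) ∘ f = id := funext hf
      rw [this, Set.image_id]
    rw [← h1, h2, ← Ideal.map_span, Ideal.comap_map_of_surjective _ Ideal.Quotient.mk_surjective,
      sup_comm]
    congr 1
    exact Ideal.mk_ker
  · rw [← hc]
    exact_mod_cast Finset.card_image_le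

end devissage

/-- Let `A → A'` be a weakly regular homomorphism of noetherian local
rings, `A' → B` a local homomorphism of noetherian local rings, and `N` a finitely
generated `B`-module. If `fd_A(N) < ∞` then `fd_{A'}(N) < ∞`. -/
theorem flatDim_finite_over_target_of_weaklyRegular
    (A : Type u) [CommRing A] [IsLocalRing A] [IsNoetherianRing A]
    (A' : Type u) [CommRing A'] [IsLocalRing A'] [IsNoetherianRing A'] [Algebra A A']
    (hwr : IsWeaklyRegularAlgebra A A')
    (B : Type u) [CommRing B] [IsLocalRing B] [IsNoetherianRing B] [Algebra A' B]
    (hloc : IsLocalHom (algebraMap A' B))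
    (N : Type u) [AddCommGroup N] [Module A N] [Module A' N] [Module B N]
    [IsScalarTower A A' N] [IsScalarTower A' B N] [Module.Finite B N]
    (h : ∃ n : ℕ, FlatDimLE A n N) :
    ∃ n : ℕ, FlatDimLE A' n N := by
  obtain ⟨n, h⟩ := h
  obtain ⟨-, hflat, hreg⟩ := hwr
  obtain ⟨d, hd⟩ := RP.of_regular hreg
  have h1 : ∀ i, EV A' (n + i + 1) (A' ⧸ Ideal.map (algebraMap A A') (maximalIdeal A)) N :=
    fun i => EV.of_equiv
      (Algebra.TensorProduct.quotIdealMapEquivTensorQuot A' (maximalIdeal A)).symm.toLinearEquiv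
      (EV.baseChange n (fun I => EV.of_flatDimLE h) i)
  have h2 := EV.koszul d hd h1 0
  exact ⟨n + d + 0, flatDimLE_of_EV fun I => EV.devissage (B := B) hloc h2 I⟩
end

section
/- For any noetherian local ring (A, m, k), the residue field k is a test module for A. -/
open CategoryTheory IsLocalRing

universe u

open TensorProduct in
theorem tor_balance {A : Type u} [CommRing A] {K P N S F L : Type u}
    [AddCommGroup K] [Module A K] [AddCommGroup P] [Module A P] [AddCommGroup N] [Module A N]
    [AddCommGroup S] [Module A S] [AddCommGroup F] [Module A F] [AddCommGroup L] [Module A L]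
    [Module.Flat A P] [Module.Flat A F]
    (ι : K →ₗ[A] P) (π : P →ₗ[A] N) (hι : Function.Injective ι) (hex : Function.Exact ι π)
    (hπ : Function.Surjective π)
    (j : S →ₗ[A] F) (q : F →ₗ[A] L) (hj : Function.Injective j) (hex' : Function.Exact j q)
    (hq : Function.Surjective q) :
    Nonempty (LinearMap.ker (j.lTensor N) ≃ₗ[A] LinearMap.ker (ι.rTensor L)) := by
  have hf := rTensor_exact S hex hπ
  have hg := rTensor_exact F hex hπ
  have h1 : (ι.rTensor F).comp (j.lTensor K) = (j.lTensor P).comp (ι.rTensor S) := by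
    rw [LinearMap.rTensor_comp_lTensor, LinearMap.lTensor_comp_rTensor]
  have h2 : (π.rTensor F).comp (j.lTensor P) = (j.lTensor N).comp (π.rTensor S) := by
    rw [LinearMap.rTensor_comp_lTensor, LinearMap.lTensor_comp_rTensor]
  have hjP : Function.Injective (j.lTensor P) :=
    Module.Flat.lTensor_preserves_injective_linearMap j hj
  have hιF : Function.Injective (ι.rTensor F) :=
    Module.Flat.rTensor_preserves_injective_linearMap ι hι
  have hι₃ : Function.Exact (LinearMap.ker (j.lTensor N)).subtype (j.lTensor N) :=
    LinearMap.exact_subtype_ker_map _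
  have hπ₁ := lTensor_exact K hex' hq
  have hπ₂ := lTensor_exact P hex' hq
  have hfs : Function.Surjective (π.rTensor S) := LinearMap.rTensor_surjective S hπ
  have hι₂ : Function.Exact (0 : PUnit.{u+1} →ₗ[A] P ⊗[A] S) (j.lTensor P) := by
    intro x
    constructor
    · intro hx
      exact ⟨0, ((injective_iff_map_eq_zero _).1 hjP x hx).symm⟩
    · rintro ⟨y, rfl⟩
      simp
  have e1 := SnakeLemma.exact_δ'_right (j.lTensor K) (j.lTensor P) (j.lTensor N)
    (ι.rTensor S) (π.rTensor S) hf (ι.rTensor F) (π.rTensor F) hg h1 h2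
    (0 : PUnit.{u+1} →ₗ[A] P ⊗[A] S) hι₂ _ hι₃ (q.lTensor K) hπ₁ hfs hιF
    (0 : PUnit.{u+1} →ₗ[A] LinearMap.ker (j.lTensor N)) (by simp) (Submodule.subtype_injective _)
  have e2 := SnakeLemma.exact_δ'_left (j.lTensor K) (j.lTensor P) (j.lTensor N)
    (ι.rTensor S) (π.rTensor S) hf (ι.rTensor F) (π.rTensor F) hg h1 h2
    _ hι₃ (q.lTensor K) hπ₁ (q.lTensor P) hπ₂ hfs hιF (ι.rTensor L)
    (by rw [LinearMap.rTensor_comp_lTensor, LinearMap.lTensor_comp_rTensor])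
    (LinearMap.lTensor_surjective K hq)
  generalize SnakeLemma.δ' (j.lTensor K) (j.lTensor P) (j.lTensor N)
    (ι.rTensor S) (π.rTensor S) hf (ι.rTensor F) (π.rTensor F) hg h1 h2
    _ hι₃ (q.lTensor K) hπ₁ hfs hιF = δ at e1 e2
  have hinj : Function.Injective δ := by
    rw [injective_iff_map_eq_zero]
    intro x hx
    obtain ⟨y, rfl⟩ := (e1 x).1 hx
    simp
  exact ⟨(LinearEquiv.ofInjective δ hinj).trans
    (LinearEquiv.ofEq _ _ (LinearMap.exact_iff.1 e2).symm)⟩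

/-- Nakayama-type property. -/
def NakProp (A : Type u) [CommRing A] [IsLocalRing A] (T : Type u) [AddCommGroup T] [Module A T] :
    Prop :=
  ∀ a ∈ maximalIdeal A, (∀ t : T, ∃ s : T, a • s = t) → Subsingleton T

theorem NakProp.of_equiv {A : Type u} [CommRing A] [IsLocalRing A] {T T' : Type u}
    [AddCommGroup T] [Module A T] [AddCommGroup T'] [Module A T'] (e : T ≃ₗ[A] T')
    (h : NakProp A T) : NakProp A T' := by
  intro a ha hs
  have := h a ha (fun t => by
    obtain ⟨s, hs⟩ := hs (e t)
    exact ⟨e.symm s, by rw [← map_smul, hs, e.symm_apply_apply]⟩)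
  exact e.symm.injective.subsingleton

/-- All `Tor₁(L, N)`, `L` finitely generated, satisfy the Nakayama property. -/
def GoodMod (A : Type u) [CommRing A] [IsLocalRing A] (N : Type u) [AddCommGroup N] [Module A N] :
    Prop :=
  ∀ (L : Type u) [AddCommGroup L] [Module A L] [Module.Finite A L]
    (K P : Type u) [AddCommGroup K] [Module A K] [AddCommGroup P] [Module A P]
    [Module.Flat A P] (ι : K →ₗ[A] P) (π : P →ₗ[A] N),
    Function.Injective ι → Function.Exact ι π → Function.Surjective π →
      NakProp A (LinearMap.ker (ι.rTensor L))

theorem exists_finite_flat_cover (A : Type u) [CommRing A] [IsNoetherianRing A]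
    (L : Type u) [AddCommGroup L] [Module A L] [Module.Finite A L] :
    ∃ (S F : Type u) (_ : AddCommGroup S) (_ : Module A S) (_ : AddCommGroup F) (_ : Module A F)
      (_ : Module.Flat A F) (_ : Module.Finite A S)
      (j : S →ₗ[A] F) (q : F →ₗ[A] L), Function.Injective j ∧ Function.Exact j q ∧
        Function.Surjective q := by
  obtain ⟨n, q, hq⟩ := Module.Finite.exists_fin' A L
  exact ⟨LinearMap.ker q, Fin n → A, inferInstance, inferInstance, inferInstance, inferInstance,
    inferInstance, inferInstance, (LinearMap.ker q).subtype, q, Submodule.subtype_injective _,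
    LinearMap.exact_subtype_ker_map _, hq⟩

open TensorProduct in
theorem finite_tensor_left {A B : Type u} [CommRing A] [CommRing B] [Algebra A B]
    (N : Type u) [AddCommGroup N] [Module A N] [Module B N] [IsScalarTower A B N]
    [Module.Finite B N] (S : Type u) [AddCommGroup S] [Module A S] [Module.Finite A S] :
    Module.Finite B (N ⊗[A] S) :=
  Module.Finite.equiv (AlgebraTensorModule.cancelBaseChange A B B N S)

theorem goodMod_of_finite {A B : Type u} [CommRing A] [IsLocalRing A] [IsNoetherianRing A]
    [CommRing B] [IsLocalRing B] [IsNoetherianRing B] [Algebra A B]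
    (hloc : IsLocalHom (algebraMap A B))
    (N : Type u) [AddCommGroup N] [Module A N] [Module B N] [IsScalarTower A B N]
    [Module.Finite B N] : GoodMod A N := by
  intro L _ _ _ K P _ _ _ _ _ ι π hι hex hπ
  obtain ⟨S, F, _, _, _, _, _, _, j, q, hj, hex', hq⟩ := exists_finite_flat_cover A L
  obtain ⟨e⟩ := tor_balance ι π hι hex hπ j q hj hex' hq
  refine NakProp.of_equiv e ?_
  intro a ha hs
  have := finite_tensor_left (A := A) (B := B) N S
  let g := TensorProduct.AlgebraTensorModule.lTensor B N j
  have hg : ∀ x, g x = j.lTensor N x := fun x => rfl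
  have hb : LinearMap.ker g = ⊥ := by
    apply Submodule.eq_bot_of_le_smul_of_le_jacobson_bot (maximalIdeal B) _
      (IsNoetherian.noetherian _) _ (IsLocalRing.maximalIdeal_le_jacobson _)
    intro t ht
    obtain ⟨s, hs⟩ := hs ⟨t, ht⟩
    have h2 : a • (s : TensorProduct A N S) = t := congrArg Subtype.val hs
    rw [← h2, ← algebraMap_smul B a (s : TensorProduct A N S)]
    refine Submodule.smul_mem_smul ?_ s.2
    rw [IsLocalRing.mem_maximalIdeal, mem_nonunits_iff] at ha ⊢
    exact fun h => ha (hloc.map_nonunit a h)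
  refine ⟨fun x y => Subtype.ext ?_⟩
  have hz : ∀ x : LinearMap.ker (j.lTensor N), (x : TensorProduct A N S) = 0 := fun x => by
    have : (x : TensorProduct A N S) ∈ LinearMap.ker g := x.2
    rwa [hb] at this
  rw [hz x, hz y]

theorem GoodMod.syzygy {A : Type u} [CommRing A] [IsLocalRing A] [IsNoetherianRing A]
    {K P N : Type u} [AddCommGroup N] [Module A N]
    [AddCommGroup K] [Module A K] [AddCommGroup P] [Module A P]
    [Module.Flat A P] (ι : K →ₗ[A] P) (π : P →ₗ[A] N)
    (hι : Function.Injective ι) (hex : Function.Exact ι π) (hπ : Function.Surjective π)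
    (hN : GoodMod A N) : GoodMod A K := by
  intro L _ _ _ K' P' _ _ _ _ _ ι' π' hι' hex' hπ'
  obtain ⟨S, F, _, _, _, _, _, _, j, q, hj, hexq, hq⟩ := exists_finite_flat_cover A L
  obtain ⟨e⟩ := tor_balance ι' π' hι' hex' hπ' j q hj hexq hq
  refine NakProp.of_equiv e ?_
  have h := hN S K P ι π hι hex hπ
  have hjP : Function.Injective (j.lTensor P) :=
    Module.Flat.lTensor_preserves_injective_linearMap j hj
  have hιF : Function.Injective (ι.rTensor F) :=
    Module.Flat.rTensor_preserves_injective_linearMap ι hι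
  have h1 : (ι.rTensor F).comp (j.lTensor K) = (j.lTensor P).comp (ι.rTensor S) := by
    rw [LinearMap.rTensor_comp_lTensor, LinearMap.lTensor_comp_rTensor]
  have : LinearMap.ker (j.lTensor K) = LinearMap.ker (ι.rTensor S) := by
    rw [← LinearMap.ker_comp_of_ker_eq_bot _ (LinearMap.ker_eq_bot.2 hιF), h1,
      LinearMap.ker_comp_of_ker_eq_bot _ (LinearMap.ker_eq_bot.2 hjP)]
  rwa [this]

theorem tor_half_exact {A : Type u} [CommRing A] {K P L' L L'' : Type u}
    [AddCommGroup K] [Module A K] [AddCommGroup P] [Module A P] [Module.Flat A P]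
    [AddCommGroup L'] [Module A L'] [AddCommGroup L] [Module A L] [AddCommGroup L''] [Module A L'']
    (ι : K →ₗ[A] P) (u : L' →ₗ[A] L) (v : L →ₗ[A] L'')
    (hu : Function.Injective u) (hex : Function.Exact u v) (hv : Function.Surjective v)
    (h'' : Function.Injective (ι.rTensor L'')) (t : TensorProduct A K L)
    (ht : ι.rTensor L t = 0) : ∃ s, ι.rTensor L' s = 0 ∧ u.lTensor K s = t := by
  have h1 : v.lTensor K t = 0 := by
    apply (injective_iff_map_eq_zero _).1 h''
    rw [← LinearMap.comp_apply, LinearMap.rTensor_comp_lTensor, ← LinearMap.lTensor_comp_rTensor,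
      LinearMap.comp_apply, ht, map_zero]
  obtain ⟨s, rfl⟩ := (lTensor_exact K hex hv t).1 h1
  refine ⟨s, ?_, rfl⟩
  apply (injective_iff_map_eq_zero _).1
    (Module.Flat.lTensor_preserves_injective_linearMap (M := P) u hu)
  rw [← LinearMap.comp_apply, LinearMap.lTensor_comp_rTensor, ← LinearMap.rTensor_comp_lTensor,
      LinearMap.comp_apply, ht]

theorem flat_of_residueField {A : Type u} [CommRing A] [IsLocalRing A] [IsNoetherianRing A]
    {K P N : Type u} [AddCommGroup N] [Module A N]
    [AddCommGroup K] [Module A K] [AddCommGroup P] [Module A P]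
    [Module.Flat A P] (ι : K →ₗ[A] P) (π : P →ₗ[A] N)
    (hι : Function.Injective ι) (hex : Function.Exact ι π) (hπ : Function.Surjective π)
    (hN : GoodMod A N) (hk : Function.Injective (ι.rTensor (ResidueField A))) :
    Module.Flat A N := by
  have key : ∀ I : Ideal A, Function.Injective (ι.rTensor (A ⧸ I)) := by
    intro I
    induction I using IsNoetherian.induction with
    | hgt I ih =>
    by_cases hIm : I = maximalIdeal A
    · subst hIm
      exact hk
    by_cases hIt : I = ⊤
    · subst hIt
      have : Subsingleton (A ⧸ (⊤ : Ideal A)) := Ideal.Quotient.subsingleton_iff.2 rfl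
      have : Subsingleton (TensorProduct A K (A ⧸ (⊤ : Ideal A))) := inferInstance
      exact Function.injective_of_subsingleton _
    obtain ⟨a, ham, haI⟩ : ∃ a ∈ maximalIdeal A, a ∉ I := by
      by_contra! hc
      exact hIm (le_antisymm (IsLocalRing.le_maximalIdeal hIt) hc)
    obtain ⟨J, hJ⟩ : ∃ J : Ideal A, ∀ x, x ∈ J ↔ a * x ∈ I :=
      ⟨Submodule.comap (LinearMap.mulLeft A a) I, fun x => Iff.rfl⟩
    have hIJ : I ≤ J := fun x hx => (hJ x).2 (Ideal.mul_mem_left I a hx)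
    let u : (A ⧸ J) →ₗ[A] (A ⧸ I) :=
      Submodule.mapQ J I (LinearMap.mulLeft A a) (fun x hx => (hJ x).1 hx)
    have hu : Function.Injective u := by
      rw [injective_iff_map_eq_zero]
      intro x hx
      obtain ⟨x, rfl⟩ := Submodule.Quotient.mk_surjective _ x
      have hx' : (Submodule.Quotient.mk (a * x) : A ⧸ I) = 0 := hx
      rw [Submodule.Quotient.mk_eq_zero] at hx' ⊢
      exact (hJ x).2 hx'
    have hle : I ≤ I ⊔ Ideal.span {a} := le_sup_left
    let v : (A ⧸ I) →ₗ[A] (A ⧸ (I ⊔ Ideal.span {a})) := Submodule.mapQ I (I ⊔ Ideal.span {a}) LinearMap.id hle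
    have hv : Function.Surjective v := by
      intro x
      obtain ⟨x, rfl⟩ := Submodule.Quotient.mk_surjective _ x
      exact ⟨Submodule.Quotient.mk x, rfl⟩
    have huv : Function.Exact u v := by
      intro x
      obtain ⟨x, rfl⟩ := Submodule.Quotient.mk_surjective _ x
      constructor
      · intro hx
        have hx' : (Submodule.Quotient.mk x : A ⧸ (I ⊔ Ideal.span {a})) = 0 := hx
        rw [Submodule.Quotient.mk_eq_zero, Submodule.mem_sup] at hx'
        obtain ⟨y, hy, z, hz, rfl⟩ := hx'
        obtain ⟨w, rfl⟩ := Ideal.mem_span_singleton'.1 hz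
        refine ⟨Submodule.Quotient.mk w, ?_⟩
        change (Submodule.Quotient.mk (a * w) : A ⧸ I) = _
        rw [Submodule.Quotient.eq]
        have : a * w - (y + w * a) = - y := by ring
        rw [this]
        exact I.neg_mem hy
      · rintro ⟨y, hy⟩
        obtain ⟨y, rfl⟩ := Submodule.Quotient.mk_surjective _ y
        rw [← hy]
        change (Submodule.Quotient.mk (a * y) : A ⧸ (I ⊔ Ideal.span {a})) = 0
        rw [Submodule.Quotient.mk_eq_zero]
        exact Ideal.mul_mem_right _ _ (Ideal.mem_sup_right (Ideal.mem_span_singleton_self a))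
    have hgt : I < I ⊔ Ideal.span {a} := lt_of_le_of_ne hle (fun h => haI (by
      rw [h]; exact Ideal.mem_sup_right (Ideal.mem_span_singleton_self a)))
    have half := tor_half_exact ι u v hu huv hv (ih _ hgt)
    by_cases hJI : J = I
    · subst hJI
      have hua : u = a • LinearMap.id := by
        ext
        simp [u]
        rfl
      have := hN (A ⧸ J) K P ι π hι hex hπ a ham (by
        rintro ⟨t, ht⟩
        obtain ⟨s, hs, hst⟩ := half t ht
        refine ⟨⟨s, hs⟩, Subtype.ext ?_⟩
        rw [hua, LinearMap.lTensor_smul, LinearMap.lTensor_id] at hst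
        exact hst)
      rw [← LinearMap.ker_eq_bot]
      exact Submodule.subsingleton_iff_eq_bot.1 this
    · have hJ' := ih J (lt_of_le_of_ne hIJ (Ne.symm hJI))
      rw [injective_iff_map_eq_zero]
      intro t ht
      obtain ⟨s, hs, rfl⟩ := half t ht
      rw [(injective_iff_map_eq_zero _).1 hJ' s hs, map_zero]
  rw [Module.Flat.iff_lTensor_injective']
  intro I
  obtain ⟨e⟩ := tor_balance ι π hι hex hπ I.subtype (Submodule.mkQ I)
    (Submodule.subtype_injective _) (LinearMap.exact_subtype_mkQ I) (Submodule.mkQ_surjective I)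
  rw [← LinearMap.ker_eq_bot, ← Submodule.subsingleton_iff_eq_bot]
  have := Submodule.subsingleton_iff_eq_bot.2 (LinearMap.ker_eq_bot.2 (key I))
  exact e.injective.subsingleton

theorem flatDimLE_of_resolution {A : Type u} [CommRing A] [IsLocalRing A] [IsNoetherianRing A]
    (n : ℕ) : ∀ (N : Type u) [AddCommGroup N] [Module A N] (_ : GoodMod A N)
    (C : ℕ → Type u) [∀ i, AddCommGroup (C i)] [∀ i, Module A (C i)] [∀ i, Module.Flat A (C i)]
    (d : ∀ i, C (i + 1) →ₗ[A] C i) (π : C 0 →ₗ[A] N) (_ : Function.Surjective π)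
    (_ : Function.Exact (d 0) π) (_ : ∀ i, Function.Exact (d (i + 1)) (d i))
    (_ : Function.Exact ((d (n + 1)).lTensor (ResidueField A)) ((d n).lTensor (ResidueField A))),
    FlatDimLE A n N := by
  induction n with
  | zero =>
    intro N _ _ hN C _ _ _ d π hπ h0 hd hk
    have hexπ := LinearMap.exact_subtype_ker_map π
    refine flat_of_residueField (LinearMap.ker π).subtype π (Submodule.subtype_injective _)
      hexπ hπ hN ?_
    rw [← LinearMap.lTensor_inj_iff_rTensor_inj, injective_iff_map_eq_zero]
    intro x hx
    let c : C 1 →ₗ[A] LinearMap.ker π := (d 0).codRestrict _ (fun y => (h0 _).2 ⟨y, rfl⟩)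
    have hc : Function.Surjective c := by
      rintro ⟨y, hy⟩
      obtain ⟨z, hz⟩ := (h0 y).1 hy
      exact ⟨z, Subtype.ext hz⟩
    have hcd : (LinearMap.ker π).subtype.comp c = d 0 := rfl
    obtain ⟨y, rfl⟩ := LinearMap.lTensor_surjective (ResidueField A) hc x
    rw [← LinearMap.comp_apply, ← LinearMap.lTensor_comp, hcd] at hx
    obtain ⟨z, rfl⟩ := (hk y).1 hx
    rw [← LinearMap.comp_apply, ← LinearMap.lTensor_comp]
    have : c.comp (d (0 + 1)) = 0 := by
      ext z
      exact (hd 0).apply_apply_eq_zero z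
    rw [this]
    simp
  | succ n ih =>
    intro N _ _ hN C _ _ _ d π hπ h0 hd hk
    refine ⟨C 0, inferInstance, inferInstance, inferInstance, π, hπ, ?_⟩
    have hexπ := LinearMap.exact_subtype_ker_map π
    refine ih (LinearMap.ker π)
      (hN.syzygy (LinearMap.ker π).subtype π (Submodule.subtype_injective _) hexπ hπ)
      (fun i => C (i + 1)) (fun i => d (i + 1))
      ((d 0).codRestrict _ (fun y => (h0 _).2 ⟨y, rfl⟩)) ?_ ?_ (fun i => hd (i + 1)) hk
    · rintro ⟨y, hy⟩
      obtain ⟨z, hz⟩ := (h0 y).1 hy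
      exact ⟨z, Subtype.ext hz⟩
    · intro x
      rw [← hd 0 x]
      exact Subtype.ext_iff

/-- For any noetherian local ring `(A, m, k)`, the residue field `k` is
a test module for `A`. -/
theorem isTestModule_residueField
    (A : Type u) [CommRing A] [IsLocalRing A] [IsNoetherianRing A] :
    IsTestModule A (ResidueField A) := by
  intro B _ _ _ _ hloc N _ _ _ _ hfin ⟨n, hn⟩
  have hN : GoodMod A N := goodMod_of_finite hloc N
  refine ⟨n, ?_⟩
  have ht := hn (n + 1) (by omega)
  let Q := projectiveResolution (ModuleCat.of A N)
  have hflat : ∀ i, Module.Flat A (Q.complex.X i) := fun i => by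
    have : Module.Projective A (Q.complex.X i) :=
      (IsProjective.iff_projective (Q.complex.X i)).2 (Q.projective i)
    infer_instance
  refine flatDimLE_of_resolution n N hN (fun i => Q.complex.X i)
    (fun i => (Q.complex.d (i + 1) i).hom) (Q.π.f 0).hom
    ((ModuleCat.epi_iff_surjective _).1 inferInstance)
    ((ShortComplex.ShortExact.moduleCat_exact_iff_function_exact _).1 Q.exact₀)
    (fun i => (ShortComplex.ShortExact.moduleCat_exact_iff_function_exact _).1 (Q.exact_succ i))
    ?_
  let G := (MonoidalCategory.tensoringLeft (ModuleCat.{u} A)).obj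
    (ModuleCat.of A (ResidueField A))
  have e := Q.isoLeftDerivedObj G (n + 1)
  have hz : Limits.IsZero (((G.mapHomologicalComplex _).obj Q.complex).homology (n + 1)) := by
    refine Limits.IsZero.of_iso ?_ e.symm
    have : Subsingleton ((G.leftDerived (n + 1)).obj (ModuleCat.of A N)) := ht
    exact ModuleCat.isZero_of_subsingleton _
  rw [← HomologicalComplex.exactAt_iff_isZero_homology,
    HomologicalComplex.exactAt_iff' _ (n + 2) (n + 1) n (by simp) (by simp),
    ShortComplex.ShortExact.moduleCat_exact_iff_function_exact] at hz
  exact hz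
end

section
/- Let A → B be a finite local homomorphism of noetherian local rings (B is finitely generated as an A-module). If B is a regular local ring, then B, regarded as an A-module, is a test module for A. -/
open CategoryTheory IsLocalRing

universe u

section RegPart

lemma reg_step {B : Type u} [CommRing B] [IsLocalRing B] [IsNoetherianRing B] (n : ℕ)
    (s : Finset B) (hs : Ideal.span (s : Set B) = maximalIdeal B) (hcard : s.card ≤ n + 1)
    (hdim : ((n + 1 : ℕ) : WithBot ℕ∞) ≤ ringKrullDim B) :
    ∃ x ∈ maximalIdeal B, (∀ q ∈ minimalPrimes B, x ∉ q) ∧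
      ∃ t : Finset (B ⧸ Ideal.span {x}), t.card ≤ n ∧ (Ideal.span (t : Set (B ⧸ Ideal.span {x}))).IsMaximal ∧
        (n : WithBot ℕ∞) ≤ ringKrullDim (B ⧸ Ideal.span {x}) := by
  classical
  have hnotmin : maximalIdeal B ∉ minimalPrimes B := by
    intro h
    have h0 : (maximalIdeal B).height = 0 := Ideal.height_eq_zero_iff.2 h
    rw [← IsLocalRing.maximalIdeal_height_eq_ringKrullDim, h0] at hdim
    have : (n + 1 : ℕ) ≤ 0 := by exact_mod_cast hdim
    omega
  have hfin : (minimalPrimes B).Finite := minimalPrimes.finite_of_isNoetherianRing B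
  have hav : ¬ ((maximalIdeal B : Set B) ⊆ ⋃ i ∈ (↑(insert (maximalIdeal B ^ 2) hfin.toFinset) : Set (Ideal B)),
      (i : Set B)) := by
    intro h
    rw [Ideal.subset_union_prime (f := fun I : Ideal B => I) (maximalIdeal B ^ 2)
      (maximalIdeal B ^ 2)] at h
    · obtain ⟨i, hi, hle⟩ := h
      rw [Finset.mem_insert] at hi
      rcases hi with rfl | hi
      · have hbot : maximalIdeal B = ⊥ := by
          apply Submodule.eq_bot_of_le_smul_of_le_jacobson_bot (maximalIdeal B) (maximalIdeal B)
            (IsNoetherian.noetherian _)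
          · rw [smul_eq_mul, ← sq]; exact hle
          · exact maximalIdeal_le_jacobson _
        apply hnotmin
        exact ⟨⟨inferInstance, bot_le⟩, fun J hJ _ => by rw [hbot]; exact bot_le⟩
      · rw [Set.Finite.mem_toFinset] at hi
        apply hnotmin
        have := hi.1.1
        rwa [← (le_maximalIdeal this.ne_top).antisymm hle]
    · intro i hi h1 _
      rw [Finset.mem_insert, Set.Finite.mem_toFinset] at hi
      exact (hi.resolve_left h1).1.1
  rw [Set.not_subset] at hav
  obtain ⟨x, hxm, hx⟩ := hav
  simp only [Finset.coe_insert, Set.mem_iUnion, not_exists] at hx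
  have hx2 : x ∉ maximalIdeal B ^ 2 := hx _ (by simp)
  have hxq : ∀ q ∈ minimalPrimes B, x ∉ q := fun q hq => hx q (by simp [hq])
  refine ⟨x, hxm, hxq, ?_⟩
  have hxs : x ∈ Ideal.span (s : Set B) := by rw [hs]; exact hxm
  obtain ⟨a, ha⟩ := (Submodule.mem_span_finset' (s := s)).1 hxs
  have : ∃ i : s, IsUnit (a i) := by
    by_contra hcon
    push Not at hcon
    apply hx2
    rw [← ha]
    refine Ideal.sum_mem _ fun i _ => ?_
    rw [sq]
    refine Ideal.mul_mem_mul ((mem_maximalIdeal _).2 (hcon i)) ?_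
    rw [← hs]
    exact Ideal.subset_span i.2
  obtain ⟨i, hi⟩ := this
  let π := Ideal.Quotient.mk (Ideal.span {x})
  have hπs : Function.Surjective π := Ideal.Quotient.mk_surjective
  have hxle : Ideal.span {x} ≤ maximalIdeal B := by
    rw [Ideal.span_singleton_le_iff_mem]; exact hxm
  refine ⟨(s.erase i).image π, ?_, ?_, ?_⟩
  · refine Finset.card_image_le.trans ?_
    rw [Finset.card_erase_of_mem i.2]
    omega
  · have hmax : (Ideal.map π (maximalIdeal B)).IsMaximal := by
      rcases Ideal.map_eq_top_or_isMaximal_of_surjective π hπs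
        (inferInstance : (maximalIdeal B).IsMaximal) with h | h
      · exfalso
        have h2 := congrArg (Ideal.comap π) h
        rw [Ideal.comap_map_of_surjective _ hπs, Ideal.comap_top] at h2
        have h3 : Ideal.comap π ⊥ = Ideal.span {x} := Ideal.mk_ker
        rw [h3, sup_eq_left.2 hxle] at h2
        exact (inferInstance : (maximalIdeal B).IsMaximal).ne_top h2
      · exact h
    convert hmax
    apply le_antisymm
    · rw [Ideal.span_le]
      intro y hy
      simp only [Finset.coe_image, Set.mem_image] at hy
      obtain ⟨z, hz, rfl⟩ := hy
      refine Ideal.mem_map_of_mem _ ?_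
      rw [← hs]
      exact Ideal.subset_span (Finset.mem_of_mem_erase (Finset.mem_coe.1 hz))
    · rw [← hs, Ideal.map_span, Ideal.span_le]
      rintro _ ⟨z, hz, rfl⟩
      have hmem : ∀ z ∈ s, z ≠ i → π z ∈ Ideal.span (((s.erase i).image π : Finset _) : Set (B ⧸ Ideal.span {x})) := by
        intro z hz hne
        refine Ideal.subset_span ?_
        simp only [Finset.coe_image]
        exact ⟨z, Finset.mem_coe.2 (Finset.mem_erase.2 ⟨hne, hz⟩), rfl⟩
      by_cases hzi : z = i
      · subst hzi
        have h0 : π x = 0 := Ideal.Quotient.eq_zero_iff_mem.2 (Ideal.mem_span_singleton_self x)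
        replace h0 := (congrArg π ((Finset.add_sum_erase _ _ (Finset.mem_univ i)).trans ha)).trans h0
        rw [map_add] at h0
        have h1 : π (a i • (i : B)) ∈ Ideal.span (((s.erase i).image π : Finset _) : Set (B ⧸ Ideal.span {x})) := by
          rw [eq_neg_of_add_eq_zero_left h0, map_sum]
          refine neg_mem (Ideal.sum_mem _ fun j hj => ?_)
          rw [smul_eq_mul, map_mul]
          refine Ideal.mul_mem_left _ _ (hmem j j.2 ?_)
          intro h
          exact (Finset.ne_of_mem_erase hj) (Subtype.ext h)
        rw [smul_eq_mul, map_mul] at h1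
        exact (Ideal.unit_mul_mem_iff_mem _ (hi.map π)).1 h1
      · exact hmem z hz hzi
  · have h := ringKrullDim_le_ringKrullDim_quotient_add_card ({x} : Finset B)
      (by simpa [ringJacobson_eq_maximalIdeal] using hxm)
    rw [Finset.card_singleton, Finset.coe_singleton] at h
    have h2 := hdim.trans h
    revert h2
    generalize ringKrullDim (B ⧸ Ideal.span {x}) = d
    intro h2
    induction d with
    | bot => simp at h2
    | coe d =>
      have h3 : ((n + 1 : ℕ) : ℕ∞) ≤ d + 1 := by exact_mod_cast h2
      have h4 : (n : ℕ∞) ≤ d := by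
        push_cast at h3
        exact (ENat.add_le_add_iff_right (by simp)).1 h3
      exact_mod_cast h4

lemma domain_of_quot {B : Type u} [CommRing B] [IsLocalRing B] [IsNoetherianRing B] {x : B}
    (hx : x ∈ maximalIdeal B) (hxq : ∀ q ∈ minimalPrimes B, x ∉ q)
    (h : IsDomain (B ⧸ Ideal.span {x})) : IsDomain B ∧ x ≠ 0 := by
  have hp : (Ideal.span {x}).IsPrime := (Ideal.Quotient.isDomain_iff_prime _).1 h
  obtain ⟨q, hq, hle⟩ := Ideal.exists_minimalPrimes_le (I := (⊥ : Ideal B)) (J := Ideal.span {x}) bot_le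
  have hqp : q.IsPrime := hq.1.1
  have hxnq := hxq q hq
  have : q = ⊥ := by
    apply Submodule.eq_bot_of_le_smul_of_le_jacobson_bot (maximalIdeal B) q
      (IsNoetherian.noetherian _) _ (maximalIdeal_le_jacobson _)
    intro y hy
    obtain ⟨z, rfl⟩ := Ideal.mem_span_singleton'.1 (hle hy)
    have hz : z ∈ q := (hqp.mem_or_mem hy).resolve_right hxnq
    rw [mul_comm]
    exact Ideal.mul_mem_mul hx hz
  subst this
  refine ⟨?_, fun h0 => hxnq (by simp [h0])⟩
  have : NoZeroDivisors B := ⟨fun {a b} hab => by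
    simpa using hqp.mem_or_mem (x := a) (y := b) (by simp [hab])⟩
  exact NoZeroDivisors.to_isDomain B

end RegPart

section TorPart
open CategoryTheory MonoidalCategory Limits

variable {A : Type u} [CommRing A] {N : ModuleCat.{u} A} (P : ProjectiveResolution N)

/-- The complex `M ⊗ P`, functorially in `M`. -/
noncomputable abbrev cpx (M : ModuleCat.{u} A) : ChainComplex (ModuleCat.{u} A) ℕ :=
  (((tensoringLeft (ModuleCat.{u} A)).obj M).mapHomologicalComplex _).obj P.complex

noncomputable abbrev cpxMap {M M' : ModuleCat.{u} A} (f : M ⟶ M') : cpx P M ⟶ cpx P M' :=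
  (NatTrans.mapHomologicalComplex ((tensoringLeft (ModuleCat.{u} A)).map f) _).app P.complex

noncomputable def TT (M : Type u) [AddCommGroup M] [Module A M] (i : ℕ) : ModuleCat.{u} A :=
  (cpx P (ModuleCat.of A M)).homology i

variable {M M' M'' : Type u} [AddCommGroup M] [Module A M] [AddCommGroup M'] [Module A M']
  [AddCommGroup M''] [Module A M'']

noncomputable def TTmap (f : M →ₗ[A] M') (i : ℕ) : TT P M i →ₗ[A] TT P M' i :=
  (HomologicalComplex.homologyMap (cpxMap P (ModuleCat.ofHom f)) i).hom

lemma cpxMap_f {M M' : ModuleCat.{u} A} (f : M ⟶ M') (i : ℕ) :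
    (cpxMap P f).f i = f ▷ P.complex.X i := rfl

lemma TTmap_comp (f : M →ₗ[A] M') (g : M' →ₗ[A] M'') (i : ℕ) :
    TTmap P (g ∘ₗ f) i = TTmap P g i ∘ₗ TTmap P f i := by
  have : cpxMap P (ModuleCat.ofHom (g ∘ₗ f)) =
      cpxMap P (ModuleCat.ofHom f) ≫ cpxMap P (ModuleCat.ofHom g) := by
    ext i : 1
    exact MonoidalCategory.comp_whiskerRight (ModuleCat.ofHom f) (ModuleCat.ofHom g) _
  unfold TTmap
  rw [this, HomologicalComplex.homologyMap_comp]
  rfl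

lemma TTmap_smul_id (x : A) (i : ℕ) :
    TTmap P (x • (LinearMap.id : M →ₗ[A] M)) i = x • LinearMap.id := by
  have : cpxMap P (ModuleCat.ofHom (x • (LinearMap.id : M →ₗ[A] M))) =
      x • 𝟙 (cpx P (ModuleCat.of A M)) := by
    ext i : 1
    rw [cpxMap_f, HomologicalComplex.smul_f_apply, HomologicalComplex.id_f]
    ext : 1
    refine TensorProduct.ext' fun m p => ?_
    change (x • m) ⊗ₜ[A] p = x • (m ⊗ₜ[A] p)
    rw [TensorProduct.smul_tmul']
  unfold TTmap
  rw [this]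
  have h : HomologicalComplex.homologyMap (x • 𝟙 (cpx P (ModuleCat.of A M))) i =
      x • HomologicalComplex.homologyMap (𝟙 (cpx P (ModuleCat.of A M))) i :=
    ShortComplex.homologyMap_smul (φ := (HomologicalComplex.shortComplexFunctor _ _ i).map
      (𝟙 (cpx P (ModuleCat.of A M)))) x
  rw [h, HomologicalComplex.homologyMap_id]
  rfl

lemma TTmap_id (i : ℕ) :
    TTmap P (LinearMap.id : M →ₗ[A] M) i = LinearMap.id := by
  have := TTmap_smul_id P (M := M) 1 i
  simpa using this

lemma TT_les (f : M →ₗ[A] M') (g : M' →ₗ[A] M'') (hf : Function.Injective f)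
    (hg : Function.Surjective g) (hfg : Function.Exact f g) :
    (∀ i, Function.Exact (TTmap P f i) (TTmap P g i)) ∧
    ∀ i, ∃ δ : TT P M'' (i + 1) →ₗ[A] TT P M i,
      Function.Exact (TTmap P g (i + 1)) δ ∧ Function.Exact δ (TTmap P f i) := by
  have h0 : cpxMap P (ModuleCat.ofHom f) ≫ cpxMap P (ModuleCat.ofHom g) = 0 := by
    ext i : 1
    ext : 1
    refine TensorProduct.ext' fun m p => ?_
    change (g (f m)) ⊗ₜ[A] p = 0
    rw [hfg.apply_apply_eq_zero, TensorProduct.zero_tmul]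
  let S := ShortComplex.mk _ _ h0
  have hS : S.ShortExact := by
    apply HomologicalComplex.shortExact_of_degreewise_shortExact
    intro i
    have : Module.Projective A (P.complex.X i) :=
      (IsProjective.iff_projective (R := A) (P := P.complex.X i)).2 (P.projective i)
    have hex : Function.Exact (f.rTensor (P.complex.X i)) (g.rTensor (P.complex.X i)) :=
      rTensor_exact _ hfg hg
    refine ShortComplex.ShortExact.mk' ?_ ?_ ?_
    · rw [ShortComplex.ShortExact.moduleCat_exact_iff_function_exact]
      exact hex
    · rw [ModuleCat.mono_iff_injective]
      exact Module.Flat.rTensor_preserves_injective_linearMap (M := P.complex.X i) f hf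
    · rw [ModuleCat.epi_iff_surjective]
      exact LinearMap.rTensor_surjective _ hg
  refine ⟨fun i => ?_, fun i => ⟨(hS.δ (i+1) i (by simp)).hom, ?_, ?_⟩⟩
  · exact (ShortComplex.ShortExact.moduleCat_exact_iff_function_exact _).1 (hS.homology_exact₂ i)
  · exact (ShortComplex.ShortExact.moduleCat_exact_iff_function_exact _).1 (hS.homology_exact₃ (i+1) i _)
  · exact (ShortComplex.ShortExact.moduleCat_exact_iff_function_exact _).1 (hS.homology_exact₁ (i+1) i _)

noncomputable def TTzero (M : Type u) [AddCommGroup M] [Module A M] :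
    TT P M 0 ≃ₗ[A] TensorProduct A M N :=
  ((ChainComplex.isoHomologyι₀ (cpx P (ModuleCat.of A M))) ≪≫
    asIso (P.fromLeftDerivedZero' ((tensoringLeft (ModuleCat.{u} A)).obj (ModuleCat.of A M)))
    ).toLinearEquiv

lemma TTzero_nat (f : M →ₗ[A] M') (x : TT P M 0) :
    TTzero P M' (TTmap P f 0 x) = f.rTensor N (TTzero P M x) := by
  have h : HomologicalComplex.homologyMap (cpxMap P (ModuleCat.ofHom f)) 0 ≫
      (ChainComplex.isoHomologyι₀ (cpx P (ModuleCat.of A M'))).hom ≫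
      P.fromLeftDerivedZero' ((tensoringLeft (ModuleCat.{u} A)).obj (ModuleCat.of A M')) =
      ((ChainComplex.isoHomologyι₀ (cpx P (ModuleCat.of A M))).hom ≫
      P.fromLeftDerivedZero' ((tensoringLeft (ModuleCat.{u} A)).obj (ModuleCat.of A M))) ≫
      (ModuleCat.ofHom f ▷ N) := by
    have h2 : HomologicalComplex.opcyclesMap (cpxMap P (ModuleCat.ofHom f)) 0 ≫
      P.fromLeftDerivedZero' ((tensoringLeft (ModuleCat.{u} A)).obj (ModuleCat.of A M')) =
      P.fromLeftDerivedZero' ((tensoringLeft (ModuleCat.{u} A)).obj (ModuleCat.of A M)) ≫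
      (ModuleCat.ofHom f ▷ N) := by
      rw [← cancel_epi (HomologicalComplex.pOpcycles _ _),
        HomologicalComplex.p_opcyclesMap_assoc,
        P.pOpcycles_comp_fromLeftDerivedZero', P.pOpcycles_comp_fromLeftDerivedZero'_assoc,
        cpxMap_f]
      exact (MonoidalCategory.whisker_exchange _ _).symm
    rw [Category.assoc, ← h2]
    exact HomologicalComplex.homologyι_naturality_assoc (cpxMap P (ModuleCat.ofHom f)) 0 _
  exact congrArg (fun k => k.hom x) h

lemma TT_iff_exact (i : ℕ) : Subsingleton (TT P M (i + 1)) ↔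
    Function.Exact ((P.complex.d (i+2) (i+1)).hom.lTensor M)
      ((P.complex.d (i+1) i).hom.lTensor M) := by
  have h : (cpx P (ModuleCat.of A M)).ExactAt (i + 1) ↔ Function.Exact
      ((P.complex.d (i+2) (i+1)).hom.lTensor M) ((P.complex.d (i+1) i).hom.lTensor M) := by
    rw [HomologicalComplex.exactAt_iff' _ (i+2) (i+1) i (by simp) (by simp),
      ShortComplex.ShortExact.moduleCat_exact_iff_function_exact]
    rfl
  rw [← h, HomologicalComplex.exactAt_iff_isZero_homology]
  exact (ModuleCat.isZero_iff_subsingleton).symm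

lemma TT_flat [Module.Flat A M] (i : ℕ) : Subsingleton (TT P M (i + 1)) :=
  (TT_iff_exact P i).2 (Module.Flat.lTensor_exact M
    ((ShortComplex.ShortExact.moduleCat_exact_iff_function_exact _).1 (P.exact_succ i)))

end TorPart

lemma torVanish_iff {A : Type u} [CommRing A] (i : ℕ)
    (M : Type u) [AddCommGroup M] [Module A M]
    (N : Type u) [AddCommGroup N] [Module A N] (P : ProjectiveResolution (ModuleCat.of A N)) :
    TorVanish A i M N ↔ Subsingleton (TT P M i) :=
  (P.isoLeftDerivedObj ((MonoidalCategory.tensoringLeft (ModuleCat.{u} A)).obj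
    (ModuleCat.of A M)) i).toLinearEquiv.toEquiv.subsingleton_congr

section RegTor

lemma TT_ker {A : Type u} [CommRing A] {N : ModuleCat.{u} A} (P : ProjectiveResolution N)
    {M M' M'' : Type u} [AddCommGroup M] [Module A M] [AddCommGroup M'] [Module A M']
    [AddCommGroup M''] [Module A M''] (f : M →ₗ[A] M') (g : M' →ₗ[A] M'')
    (hf : Function.Injective f) (hg : Function.Surjective g) (hfg : Function.Exact f g) (i : ℕ)
    (h1 : Subsingleton (TT P M i)) (h2 : Subsingleton (TT P M' (i + 1))) :
    Subsingleton (TT P M'' (i + 1)) := by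
  obtain ⟨δ, hδ, -⟩ := (TT_les P f g hf hg hfg).2 i
  refine ⟨fun a b => ?_⟩
  have key : ∀ a : TT P M'' (i + 1), a = 0 := fun a => by
    obtain ⟨y, rfl⟩ := (hδ a).1 (Subsingleton.elim _ _)
    rw [Subsingleton.elim y 0, map_zero]
  rw [key a, key b]

lemma TT_mid {A : Type u} [CommRing A] {N : ModuleCat.{u} A} (P : ProjectiveResolution N)
    {M M' M'' : Type u} [AddCommGroup M] [Module A M] [AddCommGroup M'] [Module A M']
    [AddCommGroup M''] [Module A M''] (f : M →ₗ[A] M') (g : M' →ₗ[A] M'')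
    (hf : Function.Injective f) (hg : Function.Surjective g) (hfg : Function.Exact f g) (i : ℕ)
    (h1 : Subsingleton (TT P M i)) (h2 : Subsingleton (TT P M'' i)) :
    Subsingleton (TT P M' i) := by
  have hδ := (TT_les P f g hf hg hfg).1 i
  refine ⟨fun a b => ?_⟩
  have key : ∀ a : TT P M' i, a = 0 := fun a => by
    obtain ⟨y, rfl⟩ := (hδ a).1 (Subsingleton.elim _ _)
    rw [Subsingleton.elim y 0, map_zero]
  rw [key a, key b]

lemma TT_retract {A : Type u} [CommRing A] {N : ModuleCat.{u} A} (P : ProjectiveResolution N)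
    {M M' : Type u} [AddCommGroup M] [Module A M] [AddCommGroup M'] [Module A M']
    (f : M →ₗ[A] M') (g : M' →ₗ[A] M) (hgf : g ∘ₗ f = LinearMap.id) (i : ℕ)
    (h1 : Subsingleton (TT P M' i)) : Subsingleton (TT P M i) := by
  have h := TTmap_comp P f g i
  rw [hgf, TTmap_id] at h
  refine ⟨fun a b => ?_⟩
  have key : ∀ a : TT P M i, a = 0 := fun a => by
    have := LinearMap.congr_fun h a
    rw [LinearMap.id_apply, LinearMap.comp_apply,
      Subsingleton.elim (TTmap P f i a) 0, map_zero] at this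
    exact this
  rw [key a, key b]

lemma reg_tor {A : Type u} [CommRing A] [IsLocalRing A] {N : ModuleCat.{u} A}
    (P : ProjectiveResolution N) (n : ℕ) :
    ∀ (B : Type u) [CommRing B] [IsLocalRing B] [IsNoetherianRing B] (s : Finset B),
      (Ideal.span (s : Set B)).IsMaximal → s.card ≤ n → (n : WithBot ℕ∞) ≤ ringKrullDim B →
      IsDomain B ∧ ∀ [Algebra A B], (∀ a ∈ maximalIdeal A, ¬ IsUnit (algebraMap A B a)) →
        ∀ i₀ : ℕ, (∀ i ≥ i₀, Subsingleton (TT P B i)) →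
        ∃ (W : Type u) (_ : AddCommGroup W) (_ : Module A W), Nontrivial W ∧
          (∀ a ∈ maximalIdeal A, ∀ w : W, a • w = 0) ∧
          ∃ i₁ : ℕ, ∀ i ≥ i₁, Subsingleton (TT P W i) := by
  induction n with
  | zero =>
    intro B _ _ _ s hs hc _
    have hs0 : s = ∅ := Finset.card_eq_zero.1 (Nat.le_zero.1 hc)
    subst hs0
    rw [Finset.coe_empty, Ideal.span_empty] at hs
    have hf : IsField B := by
      rw [IsLocalRing.isField_iff_maximalIdeal_eq]
      exact (IsLocalRing.eq_maximalIdeal hs).symm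
    refine ⟨hf.isDomain, ?_⟩
    intro _ hloc i₀ h
    refine ⟨B, inferInstance, inferInstance, inferInstance, ?_, i₀, h⟩
    intro a ha w
    have : algebraMap A B a = 0 := by
      by_contra hne
      obtain ⟨b, hb⟩ := hf.mul_inv_cancel hne
      exact hloc a ha (IsUnit.of_mul_eq_one b hb)
    rw [Algebra.smul_def, this, zero_mul]
  | succ n ih =>
    intro B _ _ _ s hs hc hd
    obtain ⟨x, hxm, hxq, t, htc, htm, htd⟩ := reg_step n s (IsLocalRing.eq_maximalIdeal hs) hc hd
    have hxle : Ideal.span {x} ≤ maximalIdeal B := by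
      rw [Ideal.span_singleton_le_iff_mem]; exact hxm
    have : Nontrivial (B ⧸ Ideal.span {x}) := Ideal.Quotient.nontrivial_iff.2
      (fun h => (inferInstance : (maximalIdeal B).IsMaximal).ne_top (top_le_iff.1 (h ▸ hxle)))
    have : IsLocalRing (B ⧸ Ideal.span {x}) :=
      IsLocalRing.of_surjective' (Ideal.Quotient.mk _) Ideal.Quotient.mk_surjective
    obtain ⟨hdom, hT⟩ := ih (B ⧸ Ideal.span {x}) t htm htc htd
    obtain ⟨hB, hx0⟩ := domain_of_quot hxm hxq hdom
    refine ⟨hB, ?_⟩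
    intro _ hloc i₀ h
    refine hT ?_ (i₀ + 1) ?_
    · intro a ha hu
      obtain ⟨c, hc⟩ := hu.exists_right_inv
      obtain ⟨c, rfl⟩ := Ideal.Quotient.mk_surjective c
      have h1 : Ideal.Quotient.mk (Ideal.span {x}) (algebraMap A B a * c - 1) = 0 := by
        rw [map_sub, map_mul, map_one, sub_eq_zero]
        exact hc
      have h2 := hxle (Ideal.Quotient.eq_zero_iff_mem.1 h1)
      have h3 : algebraMap A B a * c ∈ maximalIdeal B :=
        Ideal.mul_mem_right _ _ ((mem_maximalIdeal _).2 (hloc a ha))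
      have h4 := sub_mem h3 h2
      rw [sub_sub_cancel] at h4
      exact (inferInstance : (maximalIdeal B).IsMaximal).ne_top ((Ideal.eq_top_iff_one _).2 h4)
    · intro i hi
      obtain ⟨j, rfl⟩ : ∃ j, i = j + 1 := ⟨i - 1, by omega⟩
      refine TT_ker P ((LinearMap.mul A B) x)
        (Ideal.Quotient.mkₐ A (Ideal.span {x})).toLinearMap ?_ ?_ ?_ j (h j (by omega))
        (h (j + 1) (by omega))
      · intro a b hab
        exact mul_left_cancel₀ hx0 hab
      · exact Ideal.Quotient.mk_surjective
      · intro b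
        change Ideal.Quotient.mk (Ideal.span {x}) b = 0 ↔ ∃ c, x * c = b
        rw [Ideal.Quotient.eq_zero_iff_mem, Ideal.mem_span_singleton]
        exact ⟨fun ⟨c, hc⟩ => ⟨c, hc.symm⟩, fun ⟨c, hc⟩ => ⟨c, hc.symm⟩⟩

/-- `k` is a retract of any nonzero module killed by the maximal ideal. -/
lemma residue_retract {A : Type u} [CommRing A] [IsLocalRing A] (W : Type u) [AddCommGroup W]
    [Module A W] [Nontrivial W] (hW : ∀ a ∈ maximalIdeal A, ∀ w : W, a • w = 0) :
    ∃ (f : (A ⧸ maximalIdeal A) →ₗ[A] W) (g : W →ₗ[A] (A ⧸ maximalIdeal A)),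
      g ∘ₗ f = LinearMap.id := by
  have ht : Module.IsTorsionBySet A W (maximalIdeal A) := fun w a => hW a a.2 w
  letI : Field (A ⧸ maximalIdeal A) := Ideal.Quotient.field _
  letI : Module (A ⧸ maximalIdeal A) W := ht.module
  haveI : IsScalarTower A (A ⧸ maximalIdeal A) W := ht.isScalarTower
  obtain ⟨w, hw⟩ := exists_ne (0 : W)
  obtain ⟨g, hg⟩ := Module.exists_dual_forall_apply_eq_one (K := A ⧸ maximalIdeal A)
    (s := {w}) (v := id) (LinearIndepOn.singleton hw)
  refine ⟨(LinearMap.toSpanSingleton (A ⧸ maximalIdeal A) W w).restrictScalars A,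
    g.restrictScalars A, ?_⟩
  ext
  have h1 : g w = 1 := hg w rfl
  simp [h1]

end RegTor

section Nak

lemma ker_nak {A : Type u} [CommRing A] {C : Type u} [CommRing C]
    [IsLocalRing C] [IsNoetherianRing C] [Algebra A C] (N : Type u) [AddCommGroup N] [Module A N]
    [Module C N] [IsScalarTower A C N] [Module.Finite C N] (x : A)
    (hx : algebraMap A C x ∈ maximalIdeal C) (K F : Type u) [AddCommGroup K] [Module A K]
    [Module.Finite A K] [AddCommGroup F] [Module A F] (f : K →ₗ[A] F)
    (h : ∀ z : TensorProduct A N K, f.lTensor N z = 0 →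
      ∃ w : TensorProduct A N K, f.lTensor N w = 0 ∧ x • w = z) :
    ∀ z : TensorProduct A N K, f.lTensor N z = 0 → z = 0 := by
  have : Module.Finite C (TensorProduct A N K) :=
    Module.Finite.equiv (TensorProduct.AlgebraTensorModule.cancelBaseChange A C C N K)
  let Z : Submodule C (TensorProduct A N K) :=
    LinearMap.ker (TensorProduct.AlgebraTensorModule.lTensor C N f)
  have hZ : Z = ⊥ := by
    apply Submodule.eq_bot_of_le_smul_of_le_jacobson_bot (maximalIdeal C) Z
      (IsNoetherian.noetherian _)
    · intro z hz
      obtain ⟨w, hw, rfl⟩ := h z hz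
      rw [← algebraMap_smul C x w]
      exact Submodule.smul_mem_smul hx hw
    · exact maximalIdeal_le_jacobson _
  intro z hz
  have : z ∈ Z := hz
  rw [hZ] at this
  exact this

lemma TT_nak {A : Type u} [CommRing A] [IsNoetherianRing A] {C : Type u} [CommRing C]
    [IsLocalRing C] [IsNoetherianRing C] [Algebra A C] (N : Type u) [AddCommGroup N] [Module A N]
    [Module C N] [IsScalarTower A C N] [Module.Finite C N]
    (P : ProjectiveResolution (ModuleCat.of A N)) (x : A)
    (hx : algebraMap A C x ∈ maximalIdeal C) (i : ℕ) :
    ∀ (M : Type u) [AddCommGroup M] [Module A M] [Module.Finite A M],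
      (∀ a : TT P M (i + 1), ∃ b : TT P M (i + 1), x • b = a) →
      Subsingleton (TT P M (i + 1)) := by
  induction i with
  | zero =>
    intro M _ _ _ h
    obtain ⟨n, g, hg⟩ := Module.Finite.exists_fin' A M
    let K := LinearMap.ker g
    have : Module.Finite A K := Module.IsNoetherian.finite A K
    obtain ⟨δ, h1, h2⟩ := (TT_les P K.subtype g
      K.injective_subtype hg (LinearMap.exact_subtype_ker_map g)).2 0
    have hF : Subsingleton (TT P (Fin n → A) 1) := TT_flat P 0
    have hinj : ∀ a, δ a = 0 → a = 0 := by
      intro a ha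
      obtain ⟨y, rfl⟩ := (h1 a).1 ha
      rw [Subsingleton.elim y 0, map_zero]
    let e : TT P K 0 ≃ₗ[A] TensorProduct A N K :=
      (TTzero P K).trans (TensorProduct.comm A K N)
    have he : ∀ y : TT P K 0, K.subtype.lTensor N (e y) = 0 ↔ TTmap P K.subtype 0 y = 0 := by
      intro y
      have h3 := TTzero_nat P K.subtype y
      have h4 : K.subtype.lTensor N (e y) =
          TensorProduct.comm A (Fin n → A) N (K.subtype.rTensor N (TTzero P K y)) := by
        rw [← LinearMap.comm_comp_rTensor_comp_comm_eq]
        simp [e]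
      rw [h4, LinearEquiv.map_eq_zero_iff]
      refine Iff.trans ?_ (LinearEquiv.map_eq_zero_iff (TTzero P (Fin n → A)))
      rw [h3]
    have key := ker_nak (C := C) N x hx K (Fin n → A) K.subtype (by
      intro z hz
      obtain ⟨y, rfl⟩ := e.surjective z
      rw [he] at hz
      obtain ⟨a, rfl⟩ := (h2 y).1 hz
      obtain ⟨b, rfl⟩ := h a
      refine ⟨e (δ b), ?_, ?_⟩
      · rw [he]
        exact (h2 _).2 ⟨b, rfl⟩
      · rw [map_smul, map_smul])
    have hall : ∀ a : TT P M (0 + 1), a = 0 := by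
      intro a
      apply hinj
      apply e.injective
      rw [map_zero]
      apply key
      rw [he]
      exact (h2 _).2 ⟨a, rfl⟩
    exact ⟨fun a b => by rw [hall a, hall b]⟩
  | succ i ih =>
    intro M _ _ _ h
    obtain ⟨n, g, hg⟩ := Module.Finite.exists_fin' A M
    let K := LinearMap.ker g
    have : Module.Finite A K := Module.IsNoetherian.finite A K
    obtain ⟨δ, h1, h2⟩ := (TT_les P K.subtype g
      K.injective_subtype hg (LinearMap.exact_subtype_ker_map g)).2 (i + 1)
    have hF : Subsingleton (TT P (Fin n → A) (i + 1 + 1)) := TT_flat P (i + 1)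
    have hF' : Subsingleton (TT P (Fin n → A) (i + 1)) := TT_flat P i
    have hK : Subsingleton (TT P K (i + 1)) := by
      apply ih K
      intro y
      obtain ⟨a, rfl⟩ := (h2 y).1 (Subsingleton.elim _ _)
      obtain ⟨b, rfl⟩ := h a
      exact ⟨δ b, (map_smul δ x b).symm⟩
    exact TT_ker P K.subtype g K.injective_subtype hg (LinearMap.exact_subtype_ker_map g) (i + 1)
      hK hF

end Nak

section Dev

lemma TT_all {A : Type u} [CommRing A] [IsLocalRing A] [IsNoetherianRing A] {C : Type u}
    [CommRing C] [IsLocalRing C] [IsNoetherianRing C] [Algebra A C]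
    (hC : ∀ x ∈ maximalIdeal A, algebraMap A C x ∈ maximalIdeal C)
    (N : Type u) [AddCommGroup N] [Module A N]
    [Module C N] [IsScalarTower A C N] [Module.Finite C N]
    (P : ProjectiveResolution (ModuleCat.of A N)) (n : ℕ)
    (hk : ∀ i, n ≤ i → Subsingleton (TT P (A ⧸ maximalIdeal A) (i + 1))) (I : Ideal A) :
    ∀ (M : Type u) [AddCommGroup M] [Module A M] (_ : Module.Finite A M),
      (∀ a ∈ I, ∀ m : M, a • m = 0) → ∀ i, n ≤ i → Subsingleton (TT P M (i + 1)) := by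
  induction I using WellFoundedGT.induction with
  | ind I ih =>
  intro M _ _ hM
  induction hM using IsNoetherianRing.induction_on_isQuotientEquivQuotientPrime with
  | subsingleton N₁ =>
    intro _ i _
    have : Module.Flat A N₁ := inferInstance
    exact TT_flat P i
  | exact N₁ N₂ N₃ f g hf hg hfg ih1 ih3 =>
    intro h2 i hi
    refine TT_mid P f g hf hg hfg _ (ih1 ?_ i hi) (ih3 ?_ i hi)
    · intro a ha m
      apply hf
      rw [map_smul, map_zero]
      exact h2 a ha _
    · intro a ha m
      obtain ⟨m, rfl⟩ := hg m
      rw [← map_smul, h2 a ha, map_zero]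
  | quotient N₁ p e =>
    intro h1 i hi
    have hIp : I ≤ p.1 := by
      intro a ha
      have h2 : a • (Ideal.Quotient.mk p.1 1) = 0 := by
        obtain ⟨y, hy⟩ := e.surjective (Ideal.Quotient.mk p.1 1)
        rw [← hy, ← map_smul, h1 a ha, map_zero]
      rw [← Ideal.Quotient.eq_zero_iff_mem]
      have h3 : a • (Ideal.Quotient.mk p.1 1) = Ideal.Quotient.mk p.1 (a * 1) := rfl
      rwa [h3, mul_one] at h2
    refine TT_retract P e.toLinearMap e.symm.toLinearMap (by ext; simp) _ ?_
    have hkill : ∀ a ∈ p.1, ∀ m : A ⧸ p.1, a • m = 0 := by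
      intro a ha m
      obtain ⟨m, rfl⟩ := Ideal.Quotient.mk_surjective m
      have h3 : a • (Ideal.Quotient.mk p.1 m) = Ideal.Quotient.mk p.1 (a * m) := rfl
      rw [h3, Ideal.Quotient.eq_zero_iff_mem]
      exact p.1.mul_mem_right _ ha
    rcases hIp.lt_or_eq with hlt | heq
    · exact ih p.1 hlt (A ⧸ p.1) inferInstance hkill i hi
    by_cases hpm : p.1 = maximalIdeal A
    · rw [hpm]
      exact hk i hi
    obtain ⟨x, hxm, hxp⟩ : ∃ x ∈ maximalIdeal A, x ∉ p.1 := by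
      by_contra hcon
      push Not at hcon
      exact hpm (le_antisymm (le_maximalIdeal p.2.ne_top) hcon)
    apply TT_nak (C := C) N P x (hC x hxm)
    let f : (A ⧸ p.1) →ₗ[A] (A ⧸ p.1) := x • LinearMap.id
    have hf : Function.Injective f := by
      rw [injective_iff_map_eq_zero]
      intro a ha
      obtain ⟨a, rfl⟩ := Ideal.Quotient.mk_surjective a
      have h3 : Ideal.Quotient.mk p.1 (x * a) = 0 := ha
      rw [Ideal.Quotient.eq_zero_iff_mem] at h3 ⊢
      exact (p.2.mem_or_mem h3).resolve_left hxp
    have hQ : Subsingleton (TT P ((A ⧸ p.1) ⧸ LinearMap.range f) (i + 1)) := by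
      refine ih (p.1 ⊔ Ideal.span {x}) ?_ _ inferInstance ?_ i hi
      · refine lt_of_le_of_ne (hIp.trans le_sup_left) ?_
        intro h
        apply hxp
        rw [← heq, h]
        exact Ideal.mem_sup_right (Ideal.mem_span_singleton_self x)
      · intro a ha m
        obtain ⟨m, rfl⟩ := Submodule.Quotient.mk_surjective _ m
        obtain ⟨b, hb, c, hc, rfl⟩ := Submodule.mem_sup.1 ha
        obtain ⟨c, rfl⟩ := Ideal.mem_span_singleton'.1 hc
        rw [← Submodule.Quotient.mk_smul, Submodule.Quotient.mk_eq_zero, add_smul, hkill b hb,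
          zero_add, mul_comm, mul_smul]
        exact ⟨c • m, rfl⟩
    intro a
    have hex := (TT_les P f (LinearMap.range f).mkQ hf (Submodule.mkQ_surjective _)
      (LinearMap.exact_map_mkQ_range f)).1 (i + 1)
    obtain ⟨b, hb⟩ := (hex a).1 (Subsingleton.elim _ _)
    refine ⟨b, ?_⟩
    rw [← hb, TTmap_smul_id]
    rfl

open TensorProduct in
lemma flat_of_exact {A : Type u} [CommRing A] {P₃ P₂ P₁ Y : Type u} [AddCommGroup P₃]
    [AddCommGroup P₂] [AddCommGroup P₁] [AddCommGroup Y] [Module A P₃] [Module A P₂] [Module A P₁]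
    [Module A Y] (d₃ : P₃ →ₗ[A] P₂) (d₂ : P₂ →ₗ[A] P₁) (d₁ : P₁ →ₗ[A] Y) [Module.Flat A P₁]
    (h1 : Function.Surjective d₁) (h21 : Function.Exact d₂ d₁) (h32 : d₂ ∘ₗ d₃ = 0)
    (h : ∀ I : Ideal A, Function.Exact (d₃.lTensor (A ⧸ I)) (d₂.lTensor (A ⧸ I))) :
    Module.Flat A Y := by
  rw [Module.Flat.iff_rTensor_injective']
  intro I
  have comm : ∀ {M M' X X' : Type u} [AddCommGroup M] [Module A M] [AddCommGroup M'] [Module A M']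
      [AddCommGroup X] [Module A X] [AddCommGroup X'] [Module A X'] (f : M →ₗ[A] M')
      (g : X →ₗ[A] X') (z : M ⊗[A] X),
      f.rTensor X' (g.lTensor M z) = g.lTensor M' (f.rTensor X z) := by
    intro M M' X X' _ _ _ _ _ _ _ _ f g z
    rw [← LinearMap.comp_apply, ← LinearMap.comp_apply, LinearMap.rTensor_comp_lTensor,
      LinearMap.lTensor_comp_rTensor]
  have hIq : Function.Exact I.subtype I.mkQ := LinearMap.exact_subtype_mkQ I
  rw [injective_iff_map_eq_zero]
  intro z hz
  obtain ⟨u, rfl⟩ := LinearMap.lTensor_surjective I h1 z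
  rw [comm] at hz
  obtain ⟨v, hv⟩ := (lTensor_exact A h21 h1 _).1 hz
  have hv0 : d₂.lTensor (A ⧸ I) (I.mkQ.rTensor P₂ v) = 0 := by
    rw [← comm, hv]
    exact (rTensor_exact P₁ hIq I.mkQ_surjective).apply_apply_eq_zero u
  obtain ⟨w, hw⟩ := (h I _).1 hv0
  obtain ⟨w, rfl⟩ := LinearMap.rTensor_surjective P₃ I.mkQ_surjective w
  have ht : I.mkQ.rTensor P₂ (v - d₃.lTensor A w) = 0 := by
    rw [map_sub, comm, hw, sub_self]
  obtain ⟨t, ht⟩ := (rTensor_exact P₂ hIq I.mkQ_surjective _).1 ht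
  have h4 : d₂.lTensor I t = u := by
    apply Module.Flat.rTensor_preserves_injective_linearMap (M := P₁) I.subtype I.injective_subtype
    rw [comm, ht, map_sub, hv, ← LinearMap.comp_apply (d₂.lTensor A), ← LinearMap.lTensor_comp, h32,
      LinearMap.lTensor_zero, LinearMap.zero_apply, sub_zero]
  rw [← h4]
  exact (lTensor_exact I h21 h1).apply_apply_eq_zero t

lemma fd_range {A : Type u} [CommRing A] {N : ModuleCat.{u} A} (P : ProjectiveResolution N) (m : ℕ) :
    ∀ j, Module.Flat A (LinearMap.range (P.complex.d (j + m + 1) (j + m)).hom) →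
      FlatDimLE A m (LinearMap.range (P.complex.d (j + 1) j).hom) := by
  induction m with
  | zero => intro j h; exact h
  | succ m ih =>
    intro j h
    have hp : Module.Projective A (P.complex.X (j + 1)) :=
      (IsProjective.iff_projective (R := A) (P := P.complex.X (j + 1))).2 (P.projective (j + 1))
    refine ⟨P.complex.X (j + 1), inferInstance, inferInstance, inferInstance,
      (P.complex.d (j + 1) j).hom.rangeRestrict, LinearMap.surjective_rangeRestrict _, ?_⟩
    have hex : Function.Exact (P.complex.d (j + 2) (j + 1)).hom (P.complex.d (j + 1) j).hom :=
      (ShortComplex.ShortExact.moduleCat_exact_iff_function_exact _).1 (P.exact_succ j)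
    rw [LinearMap.ker_rangeRestrict, hex.linearMap_ker_eq]
    apply ih (j + 1)
    have : j + 1 + m = j + (m + 1) := by omega
    rw [this]
    exact h

lemma fd_all {A : Type u} [CommRing A] (N : Type u) [AddCommGroup N] [Module A N]
    (P : ProjectiveResolution (ModuleCat.of A N)) (n : ℕ)
    (h : ∀ I : Ideal A, Subsingleton (TT P (A ⧸ I) (n + 2))) : FlatDimLE A (n + 1) N := by
  have hp : ∀ i, Module.Projective A (P.complex.X i) := fun i =>
    (IsProjective.iff_projective (R := A) (P := P.complex.X i)).2 (P.projective i)
  have hex : ∀ j, Function.Exact (P.complex.d (j + 2) (j + 1)).hom (P.complex.d (j + 1) j).hom :=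
    fun j => (ShortComplex.ShortExact.moduleCat_exact_iff_function_exact _).1 (P.exact_succ j)
  have hflat : Module.Flat A (LinearMap.range (P.complex.d (n + 1) n).hom) := by
    have := hp (n + 1)
    refine flat_of_exact (P.complex.d (n + 3) (n + 2)).hom (P.complex.d (n + 2) (n + 1)).hom
      (P.complex.d (n + 1) n).hom.rangeRestrict (LinearMap.surjective_rangeRestrict _) ?_ ?_ ?_
    · rw [LinearMap.exact_iff, LinearMap.ker_rangeRestrict]
      exact (hex n).linearMap_ker_eq
    · exact (hex (n + 1)).linearMap_comp_eq_zero
    · intro I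
      exact (TT_iff_exact P (n + 1)).1 (h I)
  have h0 := fd_range P n 0 (by rw [Nat.zero_add]; exact hflat)
  have := hp 0
  have hex0 : Function.Exact (P.complex.d 1 0).hom (P.π.f 0).hom :=
    (ShortComplex.ShortExact.moduleCat_exact_iff_function_exact _).1 P.exact₀
  refine ⟨P.complex.X 0, inferInstance, inferInstance, inferInstance, (P.π.f 0).hom, ?_, ?_⟩
  · exact (ModuleCat.epi_iff_surjective (P.π.f 0)).1 inferInstance
  · rw [← hex0.linearMap_ker_eq] at h0
    exact h0

end Dev

/-- If `A → B` is a finite local homomorphism of noetherian local rings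
and `B` is regular, then `B`, regarded as an `A`-module, is a test module for `A`. -/
theorem isTestModule_of_finite_of_regular
    (A : Type u) [CommRing A] [IsLocalRing A] [IsNoetherianRing A]
    (B : Type u) [CommRing B] [IsLocalRing B] [IsNoetherianRing B] [Algebra A B]
    (hloc : IsLocalHom (algebraMap A B)) [Module.Finite A B]
    (hreg : IsRegularLocal B) :
    IsTestModule A B := by
  intro C _ _ _ _ hC N _ _ _ _ hN hv
  obtain ⟨i₀, hv⟩ := hv
  obtain ⟨-, -, s, hs, hd⟩ := hreg
  let P := projectiveResolution (ModuleCat.of A N)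
  obtain ⟨-, hT⟩ := reg_tor P s.card B s hs le_rfl hd.le
  obtain ⟨W, _, _, _, hW, i₁, hi₁⟩ := hT
    (fun a ha hu => (mem_maximalIdeal _).1 ha (hloc.map_nonunit a hu)) i₀
    (fun i hi => (torVanish_iff i B N P).1 (hv i hi))
  obtain ⟨f, g, hgf⟩ := residue_retract W hW
  have hk : ∀ i, i₁ ≤ i → Subsingleton (TT P (A ⧸ maximalIdeal A) (i + 1)) :=
    fun i hi => TT_retract P f g hgf _ (hi₁ (i + 1) (by omega))
  refine ⟨i₁ + 1, fd_all N P i₁ fun I => ?_⟩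
  exact TT_all (C := C)
    (fun x hx => (mem_maximalIdeal _).2 fun hu => (mem_maximalIdeal _).1 hx (hC.map_nonunit x hu))
    N P i₁ hk ⊥ (A ⧸ I) inferInstance
    (fun a ha m => by rw [Ideal.mem_bot.1 ha, zero_smul]) (i₁ + 1) (by omega)
end
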